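/- arXiv:1510.08234 — 4 statements merged into one kernel-verified Lean document; each statement's English description precedes it below -/
import Mathlib

section
/- Error bound for the least-squares objective with ℓ¹ regularization: let A be a real m×n matrix, b ∈ ℝ^m and μ > 0, and define f : ℝⁿ → ℝ by f(x) = ½‖Ax − b‖₂² + μ‖x‖₁. Then S := argmin f is nonempty, and for every R > ‖b‖₂²/(2μ) there exists a constant γ_R > 0 such that f(x) − min f ≥ 2γ_R·dist(x, S)² for every x ∈ ℝⁿ with ‖x‖₁ ≤ R, where dist is the Euclidean distance. (Lemma 3.8.) -/
open Metric Set Filter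

noncomputable section

lemma aux_eps {n : ℕ} (P : Fin n → ℝ → Prop)
    (h : ∀ i, ∃ e : ℝ, 0 < e ∧ ∀ d, 0 < d → d ≤ e → P i d) :
    ∃ e : ℝ, 0 < e ∧ ∀ i, P i e := by
  have h1 : ∀ᶠ e in nhdsWithin (0:ℝ) (Ioi 0), ∀ i, P i e := by
    rw [Filter.eventually_all]
    intro i
    obtain ⟨e, he, hP⟩ := h i
    filter_upwards [Ioc_mem_nhdsGT he] with d hd
    exact hP d hd.1 hd.2
  have h2 : ∀ᶠ e in nhdsWithin (0:ℝ) (Ioi 0), 0 < e := self_mem_nhdsWithin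
  exact (h2.and h1).exists

lemma aux_norm_le {n : ℕ} (x : EuclideanSpace ℝ (Fin n)) : ‖x‖ ≤ ∑ i, |x i| := by
  rw [EuclideanSpace.norm_eq]
  apply Real.sqrt_le_iff.2
  refine ⟨Finset.sum_nonneg fun i _ => abs_nonneg _, ?_⟩
  simp only [Real.norm_eq_abs]
  exact Finset.sum_sq_le_sq_sum_of_nonneg (fun i _ => abs_nonneg _)

lemma aux_cone {n m : ℕ} (T : EuclideanSpace ℝ (Fin n) →L[ℝ] EuclideanSpace ℝ (Fin m))
    (s : Fin n → SignType) :
    ∃ K : ℝ, 0 ≤ K ∧ ((∀ x : EuclideanSpace ℝ (Fin n),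
      (∀ i, |x i| = (s i : ℝ) * x i) → T x = 0 → x = 0) →
      ∀ x : EuclideanSpace ℝ (Fin n), (∀ i, |x i| = (s i : ℝ) * x i) → ‖x‖ ≤ K * ‖T x‖) := by
  by_cases h : ∀ x : EuclideanSpace ℝ (Fin n),
      (∀ i, |x i| = (s i : ℝ) * x i) → T x = 0 → x = 0
  swap
  · exact ⟨0, le_rfl, fun h' => absurd h' h⟩
  set C : Set (EuclideanSpace ℝ (Fin n)) := {x | ∀ i, |x i| = (s i : ℝ) * x i} with hC
  have hcl : IsClosed C := by
    rw [hC, ofPred_forall]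
    exact isClosed_iInter fun i => isClosed_eq (by fun_prop) (by fun_prop)
  have hK : IsCompact (sphere (0 : EuclideanSpace ℝ (Fin n)) 1 ∩ C) :=
    (isCompact_sphere _ _).inter_right hcl
  by_cases hne : (sphere (0 : EuclideanSpace ℝ (Fin n)) 1 ∩ C).Nonempty
  · obtain ⟨x0, hx0, hmin⟩ := hK.exists_isMinOn hne (f := fun x => ‖T x‖) (by fun_prop)
    have hx0n : ‖x0‖ = 1 := by simpa using hx0.1
    have hpos : 0 < ‖T x0‖ := by
      rw [norm_pos_iff]
      intro h0
      have := h x0 hx0.2 h0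
      rw [this] at hx0n
      simp at hx0n
    refine ⟨‖T x0‖⁻¹, by positivity, fun _ x hx => ?_⟩
    by_cases hx00 : x = 0
    · simp [hx00]
    have hxp : 0 < ‖x‖ := norm_pos_iff.2 hx00
    have hmem : (‖x‖⁻¹ • x) ∈ sphere (0 : EuclideanSpace ℝ (Fin n)) 1 ∩ C := by
      refine ⟨?_, ?_⟩
      · simp [norm_smul, hxp.ne']
      · intro i
        have := hx i
        simp only [PiLp.smul_apply, smul_eq_mul, abs_mul, abs_inv, abs_norm, this]
        ring
    have := hmin hmem
    simp only [mem_ofPred_eq, map_smul, norm_smul, norm_inv, norm_norm] at this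
    rw [inv_mul_eq_div, le_div_iff₀ hxp] at this
    rw [inv_mul_eq_div, le_div_iff₀ hpos]
    linarith
  · refine ⟨0, le_rfl, fun _ x hx => ?_⟩
    by_cases hx00 : x = 0
    · simp [hx00]
    have hxp : 0 < ‖x‖ := norm_pos_iff.2 hx00
    exfalso
    apply hne
    refine ⟨‖x‖⁻¹ • x, ?_, ?_⟩
    · simp [norm_smul, hxp.ne']
    · intro i
      have := hx i
      simp only [PiLp.smul_apply, smul_eq_mul, abs_mul, abs_inv, abs_norm, this]
      ring

/-- coordinatewise: subtracting a small same-sign number. -/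
lemma aux_coord (d w x e : ℝ) (he : 0 < e) (hw : w ∈ uIcc 0 d)
    (hx : |x| = (SignType.sign w : ℝ) * x) (hle : e * |x| ≤ |w|) :
    w - e * x ∈ uIcc 0 d ∧ |w - e * x| = |w| - e * |x| := by
  rw [mem_uIcc] at *
  rcases lt_trichotomy w 0 with h | h | h
  · simp only [sign_neg h, SignType.coe_neg_one] at hx
    rw [abs_of_neg h] at *
    rw [hx] at hle ⊢
    have hx0 : 0 ≤ -x := by
      have := abs_nonneg x
      rw [hx] at this
      linarith
    have h1 : 0 ≤ e * (-x) := by positivity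
    refine ⟨?_, ?_⟩
    · rcases hw with hw | hw
      · linarith
      · right; constructor <;> nlinarith
    · rw [abs_of_nonpos (by nlinarith)]; ring
  · have hx0 : x = 0 := by
      simpa [h] using hx
    subst hx0
    simpa using hw
  · simp only [sign_pos h, SignType.coe_one] at hx
    rw [abs_of_pos h] at *
    rw [hx] at hle ⊢
    have hx0 : 0 ≤ x := by
      have := abs_nonneg x
      rw [hx] at this
      linarith
    have h1 : 0 ≤ e * x := by positivity
    refine ⟨?_, ?_⟩
    · rcases hw with hw | hw
      · left; constructor <;> linarith
      · linarith
    · rw [abs_of_nonneg (by nlinarith)]; ring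

lemma aux_hoffman {n m : ℕ} (T : EuclideanSpace ℝ (Fin n) →L[ℝ] EuclideanSpace ℝ (Fin m)) :
    ∃ K : ℝ, 0 ≤ K ∧ ∀ d : EuclideanSpace ℝ (Fin n), ∃ w : EuclideanSpace ℝ (Fin n),
      (∀ i, w i ∈ uIcc 0 (d i)) ∧ T w = T d ∧ ‖w‖ ≤ K * ‖T d‖ := by
  choose K hK0 hK using aux_cone T
  refine ⟨∑ s, K s, Finset.sum_nonneg fun s _ => hK0 s, fun d => ?_⟩
  set D : Set (EuclideanSpace ℝ (Fin n)) := {w | (∀ i, w i ∈ uIcc 0 (d i)) ∧ T w = T d} with hD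
  have hcl : IsClosed D := by
    rw [hD, ofPred_and, ofPred_forall]
    refine IsClosed.inter (isClosed_iInter fun i => ?_) (isClosed_eq (by fun_prop) (by fun_prop))
    exact isClosed_Icc.preimage (f := fun w : EuclideanSpace ℝ (Fin n) => w i) (by fun_prop)
  have hcomp : IsCompact D := by
    refine (isCompact_closedBall (0 : EuclideanSpace ℝ (Fin n)) (∑ i, |d i|)).of_isClosed_subset
      hcl ?_
    intro w hw
    rw [mem_closedBall_zero_iff]
    refine (aux_norm_le w).trans (Finset.sum_le_sum fun i _ => ?_)
    have := abs_sub_left_of_mem_uIcc (hw.1 i)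
    simpa using this
  obtain ⟨w, hw, hmin⟩ := hcomp.exists_isMinOn ⟨d, fun i => right_mem_uIcc, rfl⟩
    (f := fun x => ∑ i, |x i|) (by fun_prop)
  refine ⟨w, hw.1, hw.2, ?_⟩
  set s : Fin n → SignType := fun i => SignType.sign (w i) with hs
  have hws : ∀ i, |w i| = (s i : ℝ) * w i := fun i => (sign_mul_self (w i)).symm
  have hker : ∀ x : EuclideanSpace ℝ (Fin n),
      (∀ i, |x i| = (s i : ℝ) * x i) → T x = 0 → x = 0 := by
    intro x hx hTx
    obtain ⟨e, he, hle⟩ := aux_eps (fun i e => e * |x i| ≤ |w i|) (by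
      intro i
      by_cases hwi : w i = 0
      · refine ⟨1, one_pos, fun t _ _ => ?_⟩
        have := hx i
        simp only [hs, hwi, sign_zero, SignType.coe_zero, zero_mul] at this
        simp [this]
      · have hwp : 0 < |w i| := abs_pos.2 hwi
        refine ⟨|w i| / (|x i| + 1), by positivity, fun t ht htle => ?_⟩
        rw [le_div_iff₀ (by positivity)] at htle
        nlinarith)
    have hco := fun i => aux_coord (d i) (w i) (x i) e he (hw.1 i) (hx i) (hle i)
    have hmem : w - e • x ∈ D := by
      refine ⟨fun i => ?_, ?_⟩
      · simpa using (hco i).1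
      · simp [hTx, hw.2]
    have h1 := hmin hmem
    simp only [mem_ofPred_eq, PiLp.sub_apply, PiLp.smul_apply, smul_eq_mul] at h1
    rw [Finset.sum_congr rfl fun i _ => (hco i).2, Finset.sum_sub_distrib, ← Finset.mul_sum] at h1
    have h2 : ∑ i, |x i| ≤ 0 := by
      by_contra hc
      push Not at hc
      nlinarith [mul_pos he hc]
    exact norm_le_zero_iff.1 ((aux_norm_le x).trans h2)
  have := hK s hker w hws
  rw [hw.2] at this
  refine this.trans (mul_le_mul_of_nonneg_right ?_ (norm_nonneg _))
  exact Finset.single_le_sum (fun s _ => hK0 s) (Finset.mem_univ s)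

lemma aux_phi (μ g : ℝ) (h : ∀ t : ℝ, 0 ≤ μ * |t| + g * t) :
    ∃ e : ℝ, 0 < e ∧ ∀ c, 0 < c → c ≤ e →
      ∀ t : ℝ, μ * |t| + g * t = 0 ∨ c * |t| ≤ μ * |t| + g * t := by
  have h1 := h 1
  have h2 := h (-1)
  simp only [abs_one, abs_neg, mul_one, mul_neg] at h1 h2
  have key : ∀ a : ℝ, 0 ≤ a → ∃ e : ℝ, 0 < e ∧ (a = 0 ∨ e ≤ a) := by
    intro a ha
    rcases ha.eq_or_lt with h | h
    · exact ⟨1, one_pos, Or.inl h.symm⟩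
    · exact ⟨a, h, Or.inr le_rfl⟩
  obtain ⟨e1, he1, hh1⟩ := key _ h1
  obtain ⟨e2, he2, hh2⟩ := key _ h2
  refine ⟨min e1 e2, lt_min he1 he2, fun c hc hce t => ?_⟩
  have hc1 := hce.trans (min_le_left _ _)
  have hc2 := hce.trans (min_le_right _ _)
  rcases le_total 0 t with ht | ht
  · rw [abs_of_nonneg ht]
    rcases hh1 with h | h
    · left; rw [← add_mul, h, zero_mul]
    · right; nlinarith
  · rw [abs_of_nonpos ht]
    rcases hh2 with h | h
    · left; linear_combination (-t) * h
    · right; nlinarith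

lemma aux_between (μ g : ℝ) (hμ : 0 < μ) (h : ∀ t : ℝ, 0 ≤ μ * |t| + g * t) (a z w : ℝ)
    (ha : μ * |a| + g * a = 0) (hz : μ * |z| + g * z = 0) (hw : w ∈ uIcc 0 (z - a)) :
    μ * |a + w| + g * (a + w) = 0 := by
  have hcv : ConvexOn ℝ univ (fun t : ℝ => μ * |t| + g * t) := by
    have h1 : ConvexOn ℝ univ (fun t : ℝ => |t|) := convexOn_norm convex_univ
    have h2 : ConvexOn ℝ univ (fun t : ℝ => g * t) := (LinearMap.mulLeft ℝ g).convexOn convex_univ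
    exact (h1.smul hμ.le).add h2
  have hmem : a + w ∈ segment ℝ a z := by
    rw [segment_eq_uIcc]
    rw [mem_uIcc] at *
    rcases hw with hw | hw
    · left; constructor <;> linarith
    · right; constructor <;> linarith
  have := hcv.le_on_segment (mem_univ a) (mem_univ z) hmem
  simp only [ha, hz, max_self] at this
  exact le_antisymm this (h _)

set_option maxHeartbeats 2000000

theorem stmt4 (m n : ℕ) (A : Matrix (Fin m) (Fin n) ℝ)
    (b : EuclideanSpace ℝ (Fin m)) (μ : ℝ) (hμ : 0 < μ)
    (f : EuclideanSpace ℝ (Fin n) → ℝ)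
    (hf : ∀ x, f x = (1 / 2) * ‖Matrix.toEuclideanLin A x - b‖ ^ 2 + μ * ∑ i, |x i|) :
    {z : EuclideanSpace ℝ (Fin n) | ∀ y, f z ≤ f y}.Nonempty ∧
    ∀ R : ℝ, ‖b‖ ^ 2 / (2 * μ) < R → ∃ γ : ℝ, 0 < γ ∧
      ∀ x : EuclideanSpace ℝ (Fin n), (∑ i, |x i|) ≤ R →
        ∀ z : EuclideanSpace ℝ (Fin n), (∀ y, f z ≤ f y) →
          2 * γ * Metric.infDist x {z : EuclideanSpace ℝ (Fin n) | ∀ y, f z ≤ f y} ^ 2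
            ≤ f x - f z := by
  obtain ⟨T, hT⟩ : ∃ T : EuclideanSpace ℝ (Fin n) →L[ℝ] EuclideanSpace ℝ (Fin m),
      ∀ x, Matrix.toEuclideanLin A x = T x :=
    ⟨LinearMap.toContinuousLinearMap (Matrix.toEuclideanLin A), fun x => rfl⟩
  simp only [hT] at hf
  have hfc : Continuous f := by
    rw [funext hf]
    fun_prop
  have hne : {z : EuclideanSpace ℝ (Fin n) | ∀ y, f z ≤ f y}.Nonempty := by
    apply hfc.exists_forall_le' 0
    have h1 := (tendsto_norm_cocompact_atTop (E := EuclideanSpace ℝ (Fin n))).eventually_ge_atTop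
      (f 0 / μ)
    filter_upwards [h1] with x hx
    rw [div_le_iff₀ hμ] at hx
    rw [hf x]
    have h2 := aux_norm_le x
    nlinarith [sq_nonneg ‖T x - b‖]
  refine ⟨hne, fun R hR => ?_⟩
  have hR0 : 0 < R := lt_of_le_of_lt (by positivity) hR
  obtain ⟨z0, hz0⟩ := hne
  set g : EuclideanSpace ℝ (Fin n) := ContinuousLinearMap.adjoint T (T z0 - b) with hg
  have hgin : ∀ y, inner ℝ (T z0 - b) (T y) = ∑ i, g i * y i := by
    intro y
    rw [← ContinuousLinearMap.adjoint_inner_left, ← hg, PiLp.inner_apply]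
    exact Finset.sum_congr rfl fun i _ => by simp [mul_comm]
  -- expansion
  have hexp : ∀ y, f y = f z0 + (1/2) * ‖T (y - z0)‖^2 + (∑ i, (μ * |y i| + g i * y i))
      - ∑ i, (μ * |z0 i| + g i * z0 i) := by
    intro y
    have h1 : T y - b = (T z0 - b) + T (y - z0) := by rw [map_sub]; abel
    have h2 : inner ℝ (T z0 - b) (T (y - z0)) = ∑ i, g i * y i - ∑ i, g i * z0 i := by
      rw [map_sub, inner_sub_right, hgin, hgin]
    rw [hf y, hf z0, h1, norm_add_sq_real, h2, Finset.sum_add_distrib, Finset.sum_add_distrib,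
      ← Finset.mul_sum, ← Finset.mul_sum]
    ring
  set Φ : EuclideanSpace ℝ (Fin n) → ℝ := fun y => ∑ i, (μ * |y i| + g i * y i) with hΦ
  have hexp' : ∀ y, f y = f z0 + (1/2) * ‖T (y - z0)‖^2 + Φ y - Φ z0 := hexp
  have hΦcv : ∀ (y : EuclideanSpace ℝ (Fin n)) (s : ℝ), 0 < s → s ≤ 1 →
      Φ (z0 + s • (y - z0)) ≤ Φ z0 + s * (Φ y - Φ z0) := by
    intro y s hs hs1
    simp only [hΦ]
    rw [← Finset.sum_sub_distrib, Finset.mul_sum, ← Finset.sum_add_distrib]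
    apply Finset.sum_le_sum
    intro i _
    simp only [PiLp.add_apply, PiLp.smul_apply, PiLp.sub_apply, smul_eq_mul]
    have h1 : |z0 i + s * (y i - z0 i)| ≤ (1 - s) * |z0 i| + s * |y i| := by
      have : z0 i + s * (y i - z0 i) = (1 - s) * z0 i + s * y i := by ring
      rw [this]
      refine (abs_add_le _ _).trans ?_
      rw [abs_mul, abs_mul, abs_of_nonneg (sub_nonneg.2 hs1), abs_of_pos hs]
    nlinarith
  have hΦmin : ∀ y, Φ z0 ≤ Φ y := by
    intro y
    by_contra hc
    push Not at hc
    set q := ‖T (y - z0)‖^2 with hq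
    have hq0 : 0 ≤ q := by positivity
    have hall : ∀ s : ℝ, 0 < s → s ≤ 1 → Φ z0 - Φ y ≤ s * (1/2) * q := by
      intro s hs hs1
      have h1 := hz0 (z0 + s • (y - z0))
      rw [hexp' (z0 + s • (y - z0))] at h1
      have h2 := hΦcv y s hs hs1
      rw [add_sub_cancel_left, map_smul, norm_smul, Real.norm_eq_abs, mul_pow, sq_abs, ← hq] at h1
      have h3 : s * (Φ z0 - Φ y) ≤ s * (s * (1/2) * q) := by nlinarith
      exact le_of_mul_le_mul_left h3 hs
    set D := Φ z0 - Φ y with hDd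
    have hD : 0 < D := by linarith
    have h4 := hall (D / (D + q)) (by positivity) (by rw [div_le_one (by positivity)]; linarith)
    have h5 : D / (D + q) * (1/2) * q ≤ D * (1/2) := by
      have : D / (D + q) * (1/2) * q = D * (1/2) * (q / (D+q)) := by ring
      rw [this]
      apply mul_le_of_le_one_right (by positivity)
      rw [div_le_one (by positivity)]; linarith
    linarith
  have hΦz0 : Φ z0 = 0 := by
    have h1 := hΦmin 0
    have h2 := hΦmin ((2:ℝ) • z0)
    have h3 : Φ 0 = 0 := by simp [hΦ]
    have h4 : Φ ((2:ℝ) • z0) = 2 * Φ z0 := by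
      simp only [hΦ, Finset.mul_sum]
      refine Finset.sum_congr rfl fun i _ => ?_
      simp only [PiLp.smul_apply, smul_eq_mul, abs_mul, abs_two]
      ring
    linarith
  have hphi : ∀ i, ∀ t : ℝ, 0 ≤ μ * |t| + g i * t := by
    intro i t
    have h1 := hΦmin (EuclideanSpace.single i t)
    rw [hΦz0] at h1
    simp only [hΦ] at h1
    rw [Finset.sum_eq_single i] at h1
    · simpa using h1
    · intro j _ hj
      simp [hj]
    · simp
  have hz0i : ∀ i, μ * |z0 i| + g i * z0 i = 0 := by
    intro i
    exact (Finset.sum_eq_zero_iff_of_nonneg (fun i _ => hphi i (z0 i))).1 hΦz0 i (Finset.mem_univ i)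
  obtain ⟨c, hc, hcphi⟩ := aux_eps
    (fun i c => ∀ t : ℝ, μ * |t| + g i * t = 0 ∨ c * |t| ≤ μ * |t| + g i * t)
    (fun i => aux_phi μ (g i) (hphi i))
  obtain ⟨K, hK0, hK⟩ := aux_hoffman T
  set L := ‖T‖ with hL
  have hL0 : 0 ≤ L := norm_nonneg _
  set M : ℝ := 2 * (1 + K * L)^2 * (R / c) + 4 * K^2 with hM
  have hM0 : 0 < M := by positivity
  refine ⟨1 / (2 * M), by positivity, fun x hx z hz => ?_⟩
  have hfz : f z = f z0 := le_antisymm (hz z0) (hz0 z)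
  have hF := hexp' x
  rw [hΦz0] at hF
  set x' : EuclideanSpace ℝ (Fin n) :=
    WithLp.toLp 2 (fun i => if μ * |x i| + g i * x i = 0 then x i else 0) with hx'
  have hx'i : ∀ i, x' i = if μ * |x i| + g i * x i = 0 then x i else 0 := fun i => rfl
  have hx'0 : ∀ i, μ * |x' i| + g i * x' i = 0 := by
    intro i
    rw [hx'i]
    split_ifs with h
    · exact h
    · simp
  have he1 : ∀ i, |(x - x') i| ≤ |x i| := by
    intro i
    rw [PiLp.sub_apply, hx'i]
    split_ifs with h <;> simp
  have he2 : ∀ i, c * |(x - x') i| ≤ μ * |x i| + g i * x i := by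
    intro i
    rw [PiLp.sub_apply, hx'i]
    split_ifs with h
    · simp [h]
    · rw [sub_zero]
      exact (hcphi i (x i)).resolve_left h
  set e := ∑ i, |(x - x') i| with he
  have he0 : 0 ≤ e := Finset.sum_nonneg fun i _ => abs_nonneg _
  have heR : e ≤ R := (Finset.sum_le_sum fun i _ => he1 i).trans hx
  have heΦ : c * e ≤ Φ x := by
    rw [he, Finset.mul_sum]
    exact Finset.sum_le_sum fun i _ => he2 i
  obtain ⟨w, hw, hTw, hwn⟩ := hK (z0 - x')
  have hy : x' + w ∈ {z : EuclideanSpace ℝ (Fin n) | ∀ y, f z ≤ f y} := by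
    intro y
    refine le_trans (le_of_eq ?_) (hz0 y)
    rw [hexp' (x' + w), hΦz0]
    have h1 : T (x' + w - z0) = 0 := by
      rw [map_sub, map_add, hTw, map_sub]; abel
    have h2 : Φ (x' + w) = 0 := by
      apply Finset.sum_eq_zero
      intro i _
      exact aux_between μ (g i) hμ (hphi i) (x' i) (z0 i) (w i) (hx'0 i) (hz0i i) (hw i)
    rw [h1, h2]
    simp
  have hdist := infDist_le_dist_of_mem (x := x) hy
  have hd0 : 0 ≤ infDist x {z : EuclideanSpace ℝ (Fin n) | ∀ y, f z ≤ f y} := infDist_nonneg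
  set δ := infDist x {z : EuclideanSpace ℝ (Fin n) | ∀ y, f z ≤ f y} with hδ
  set a := ‖T (x - z0)‖ with ha
  have ha0 : 0 ≤ a := norm_nonneg _
  have hTb : ‖T (z0 - x')‖ ≤ a + L * e := by
    have h1 : T (z0 - x') = T (x - x') - T (x - z0) := by
      rw [← map_sub]; congr 1; abel
    rw [h1]
    refine (norm_sub_le _ _).trans ?_
    have h2 := T.le_opNorm (x - x')
    have h3 := mul_le_mul_of_nonneg_left (aux_norm_le (x - x')) hL0
    linarith
  have hδ1 : δ ≤ (1 + K * L) * e + K * a := by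
    refine hdist.trans ?_
    rw [dist_eq_norm, show x - (x' + w) = (x - x') - w by abel]
    refine (norm_sub_le _ _).trans ?_
    have h2 := aux_norm_le (x - x')
    have h3 := mul_le_mul_of_nonneg_left hTb hK0
    nlinarith
  have hΦ0 : 0 ≤ Φ x := le_trans (by positivity) heΦ
  have he3 : e ^ 2 ≤ (R / c) * Φ x := by
    rw [div_mul_eq_mul_div, le_div_iff₀ hc]
    nlinarith [mul_le_mul heR heΦ (by positivity) hR0.le]
  have hδ2 : δ ^ 2 ≤ M * (f x - f z) := by
    have h1 : δ ^ 2 ≤ ((1 + K * L) * e + K * a) ^ 2 := pow_le_pow_left₀ hd0 hδ1 2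
    have h2 : ((1 + K * L) * e + K * a) ^ 2 ≤ 2 * ((1 + K * L)^2 * e^2) + 2 * (K^2 * a^2) := by
      have := sq_nonneg ((1 + K * L) * e - K * a)
      linarith [show 2 * ((1 + K * L)^2 * e^2) + 2 * (K^2 * a^2) - ((1 + K * L) * e + K * a) ^ 2
        = ((1 + K * L) * e - K * a) ^ 2 by ring]
    have h3 := mul_le_mul_of_nonneg_left he3 (sq_nonneg (1 + K * L))
    have h4 : f x - f z = (1/2) * a^2 + Φ x := by rw [hfz, hF]; ring
    rw [h4, hM]
    have h5 : 0 ≤ (1 + K * L)^2 * (R / c) * a^2 := by positivity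
    have h6 : 0 ≤ K^2 * Φ x := by positivity
    nlinarith
  have : 2 * (1 / (2 * M)) * δ ^ 2 = δ ^ 2 / M := by field_simp
  rw [this, div_le_iff₀ hM0]
  linarith
end
end

section
/- Complexity of the alternating projection method for regular convex sets: let C₁, C₂ be closed convex subsets of H with B(x̄, R) ⊆ C₁ ∩ C₂ for some x̄ ∈ H and R > 0, let x₀ ∈ C₁, and define the sequence x_{k+1} = P_{C₁}(P_{C₂}(x_k)). Set M′ = (1/8)·(1 + 2‖x₀ − x̄‖/R)^{−2}. Then x_k ∈ C₁ for all k ≥ 0, (x_k) converges strongly to some x* ∈ C₁ ∩ C₂, and for all k: dist(x_k, C₂) ≤ dist(x₀, C₂)/(1 + M′/4)^{k/2} (k ≥ 0), and ‖x_k − x*‖ ≤ [1 + 8/(M′·√(1 + 4/M′))] · dist(x₀, C₂) / (1 + M′/4)^{(k−1)/2} (k ≥ 1). -/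
open Metric Set Filter

noncomputable section

lemma le_of_sq_aux {a b : ℝ} (h : a ^ 2 ≤ b ^ 2) (hb : 0 ≤ b) : a ≤ b :=
  abs_le_of_sq_le_sq' h hb |>.2

lemma proj_inner {H : Type*} [NormedAddCommGroup H] [InnerProductSpace ℝ H]
    {C : Set H} (hconv : Convex ℝ C) {z p : H} (hp : p ∈ C)
    (hmin : ∀ y ∈ C, ‖z - p‖ ≤ ‖z - y‖) : ∀ y ∈ C, inner ℝ (z - p) (y - p) ≤ 0 := by
  rw [← norm_eq_iInf_iff_real_inner_le_zero hconv hp]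
  have : Nonempty C := ⟨⟨p, hp⟩⟩
  apply le_antisymm
  · exact le_ciInf fun y => hmin y y.2
  · exact ciInf_le (f := fun w : C => ‖z - w‖)
      ⟨0, by rintro _ ⟨y, rfl⟩; exact norm_nonneg _⟩ ⟨p, hp⟩

lemma proj_sq {H : Type*} [NormedAddCommGroup H] [InnerProductSpace ℝ H]
    {z p y : H} (h : inner ℝ (z - p) (y - p) ≤ 0) :
    ‖p - y‖ ^ 2 + ‖z - p‖ ^ 2 ≤ ‖z - y‖ ^ 2 := by
  have e : z - y = (z - p) - (y - p) := by abel
  rw [e, norm_sub_sq_real (z - p) (y - p), norm_sub_rev p y]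
  linarith

lemma proj_infDist {H : Type*} [NormedAddCommGroup H] [InnerProductSpace ℝ H]
    {C : Set H} {z p : H} (hp : p ∈ C)
    (hmin : ∀ y ∈ C, ‖z - p‖ ≤ ‖z - y‖) : Metric.infDist z C = ‖z - p‖ := by
  apply le_antisymm
  · rw [← dist_eq_norm]; exact Metric.infDist_le_dist_of_mem hp
  · rw [Metric.le_infDist ⟨p, hp⟩]
    intro y hy
    rw [dist_eq_norm]; exact hmin y hy

/-- linear regularity -/
lemma exists_near {H : Type*} [NormedAddCommGroup H] [InnerProductSpace ℝ H]
    {C₁ C₂ : Set H} (h1 : Convex ℝ C₁) (h2 : Convex ℝ C₂) {xbar : H} {R : ℝ} (hR : 0 < R)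
    (hball : closedBall xbar R ⊆ C₁ ∩ C₂) {x y : H} (hx : x ∈ C₁) (hy : y ∈ C₂) :
    ∃ w ∈ C₁ ∩ C₂, ‖x - w‖ ≤ ‖x - xbar‖ / R * ‖x - y‖ := by
  have hxb : xbar ∈ C₁ := (hball (mem_closedBall_self hR.le)).1
  rcases eq_or_lt_of_le (norm_nonneg (x - y)) with h0 | hd
  · have : x = y := by rw [← sub_eq_zero, ← norm_eq_zero, ← h0]
    refine ⟨x, ⟨hx, this ▸ hy⟩, ?_⟩
    simp only [sub_self, norm_zero]
    positivity
  set d := ‖x - y‖ with hdd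
  have hRd : 0 < R + d := by linarith
  have hsum : R / (R + d) + d / (R + d) = 1 := by field_simp
  refine ⟨(R / (R + d)) • x + (d / (R + d)) • xbar, ⟨?_, ?_⟩, ?_⟩
  · exact h1 hx hxb (by positivity) (by positivity) hsum
  · have hb : xbar + (R / d) • (x - y) ∈ C₂ := by
      apply (hball _).2
      rw [mem_closedBall, dist_eq_norm, add_sub_cancel_left, norm_smul, Real.norm_of_nonneg
        (by positivity), ← hdd]
      apply le_of_eq; field_simp
    have := h2 hy hb (a := R / (R + d)) (b := d / (R + d)) (by positivity) (by positivity) hsum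
    convert this using 1
    rw [smul_add, smul_smul, smul_sub]
    have : d / (R + d) * (R / d) = R / (R + d) := by field_simp
    rw [this]; abel
  · have e : x - ((R / (R + d)) • x + (d / (R + d)) • xbar) = (d / (R + d)) • (x - xbar) := by
      have : x = (R / (R + d) + d / (R + d)) • x := by rw [hsum, one_smul]
      nth_rewrite 1 [this]
      rw [add_smul, smul_sub]; abel
    rw [e, norm_smul, Real.norm_of_nonneg (by positivity)]
    have : d / (R + d) ≤ d / R := by gcongr; linarith
    calc d / (R + d) * ‖x - xbar‖ ≤ d / R * ‖x - xbar‖ := by gcongr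
      _ = _ := by ring

/-- one-step contraction -/
lemma contract {H : Type*} [NormedAddCommGroup H] [InnerProductSpace ℝ H]
    {x y p w : H} {c : ℝ} (hc : 0 ≤ c) (hw : ‖x - w‖ ≤ c * ‖x - y‖)
    (h1 : inner ℝ (x - y) (w - y) ≤ 0) (h2 : inner ℝ (y - p) (w - p) ≤ 0)
    (h3 : inner ℝ (y - p) (x - p) ≤ 0) :
    ‖y - p‖ ^ 2 ≤ (1 - 1 / (1 + c) ^ 2) * ‖x - y‖ ^ 2 := by
  have hs : ‖p - x‖ ^ 2 + ‖y - p‖ ^ 2 ≤ ‖y - x‖ ^ 2 := proj_sq h3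
  rw [norm_sub_rev p x, norm_sub_rev y x] at hs
  have hed : ‖y - p‖ ≤ ‖x - y‖ := by
    apply le_of_sq_aux _ (norm_nonneg _)
    nlinarith [sq_nonneg ‖x - p‖]
  have key : ‖x - y‖ ^ 2 ≤ inner ℝ (x - p) (x - w) + inner ℝ (p - y) (x - p) := by
    have e1 : inner ℝ (x - y) (w - y) =
        ‖x - y‖ ^ 2 - inner ℝ (x - p) (x - w) - inner ℝ (p - y) (x - p)
          + inner ℝ (y - p) (p - w) := by
      rw [← real_inner_self_eq_norm_sq]
      simp only [inner_sub_left, inner_sub_right]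
      ring
    have e2 : inner ℝ (y - p) (p - w) = - inner ℝ (y - p) (w - p) := by
      rw [← inner_neg_right, neg_sub]
    linarith
  have k1 := real_inner_le_norm (x - p) (x - w)
  have k2 := real_inner_le_norm (p - y) (x - p)
  rw [norm_sub_rev p y] at k2
  have hn := norm_nonneg (x - p)
  have hd := norm_nonneg (x - y)
  have k3 : ‖x - y‖ ^ 2 ≤ ‖x - p‖ * ((1 + c) * ‖x - y‖) := by
    nlinarith [mul_le_mul_of_nonneg_left hw hn, mul_le_mul_of_nonneg_left hed hn]
  have k4 : ‖x - y‖ ≤ ‖x - p‖ * (1 + c) := by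
    rcases eq_or_lt_of_le hd with h | h
    · rw [← h]; positivity
    · nlinarith
  have k5 : ‖x - y‖ ^ 2 / (1 + c) ^ 2 ≤ ‖x - p‖ ^ 2 := by
    rw [div_le_iff₀ (by positivity), ← mul_pow]
    gcongr
  have : (1 - 1 / (1 + c) ^ 2) * ‖x - y‖ ^ 2 = ‖x - y‖ ^ 2 - ‖x - y‖ ^ 2 / (1 + c) ^ 2 := by ring
  linarith

/-- **Complexity of the alternating projection method for regular convex
sets**: `C₁, C₂` closed convex with `B(x̄,R) ⊆ C₁ ∩ C₂`, `x₀ ∈ C₁`,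
`x_{k+1} = P_{C₁}(P_{C₂}(x_k))` (with `P_{C₁}, P_{C₂}` the metric projections),
and `M' = (1/8)(1 + 2‖x₀ − x̄‖/R)⁻².  Then `x_k ∈ C₁` for all `k`, `x_k`
converges strongly to some `x* ∈ C₁ ∩ C₂`,
`dist(x_k,C₂) ≤ dist(x₀,C₂)/(1+M'/4)^{k/2}` for `k ≥ 0`, and
`‖x_k − x*‖ ≤ [1 + 8/(M'√(1+4/M'))]·dist(x₀,C₂)/(1+M'/4)^{(k−1)/2}` for
`k ≥ 1`. -/
theorem stmt15 {H : Type*} [NormedAddCommGroup H] [InnerProductSpace ℝ H]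
    [CompleteSpace H]
    (C₁ C₂ : Set H)
    (hclosed₁ : IsClosed C₁) (hconv₁ : Convex ℝ C₁)
    (hclosed₂ : IsClosed C₂) (hconv₂ : Convex ℝ C₂)
    (xbar : H) (R : ℝ) (hR : 0 < R)
    (hball : closedBall xbar R ⊆ C₁ ∩ C₂)
    (P₁ P₂ : H → H)
    (hP₁ : ∀ z, P₁ z ∈ C₁ ∧ ∀ y ∈ C₁, ‖z - P₁ z‖ ≤ ‖z - y‖)
    (hP₂ : ∀ z, P₂ z ∈ C₂ ∧ ∀ y ∈ C₂, ‖z - P₂ z‖ ≤ ‖z - y‖)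
    (x : ℕ → H) (hx0 : x 0 ∈ C₁)
    (hiter : ∀ k : ℕ, x (k + 1) = P₁ (P₂ (x k)))
    (M' : ℝ)
    (hM' : M' = (1 / 8) * (1 + 2 * ‖x 0 - xbar‖ / R) ^ ((-2 : ℤ))) :
    (∀ k : ℕ, x k ∈ C₁) ∧
    ∃ xstar ∈ C₁ ∩ C₂, Tendsto x atTop (nhds xstar) ∧
      (∀ k : ℕ, Metric.infDist (x k) C₂ ≤
        Metric.infDist (x 0) C₂ / (1 + M' / 4) ^ ((k : ℝ) / 2)) ∧
      ∀ k : ℕ, 1 ≤ k → ‖x k - xstar‖ ≤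
        (1 + 8 / (M' * Real.sqrt (1 + 4 / M'))) * Metric.infDist (x 0) C₂ /
          (1 + M' / 4) ^ (((k : ℝ) - 1) / 2) := by
  have hxb := hball (mem_closedBall_self hR.le)
  have i₁ : ∀ z, ∀ y ∈ C₁, inner ℝ (z - P₁ z) (y - P₁ z) ≤ 0 :=
    fun z => proj_inner hconv₁ (hP₁ z).1 (hP₁ z).2
  have i₂ : ∀ z, ∀ y ∈ C₂, inner ℝ (z - P₂ z) (y - P₂ z) ≤ 0 :=
    fun z => proj_inner hconv₂ (hP₂ z).1 (hP₂ z).2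
  have hmem : ∀ k, x k ∈ C₁ := by
    intro k
    cases k with
    | zero => exact hx0
    | succ k => rw [hiter]; exact (hP₁ _).1
  have hdist : ∀ z, infDist z C₂ = ‖z - P₂ z‖ := fun z => proj_infDist (hP₂ z).1 (hP₂ z).2
  have fejer1 : ∀ w ∈ C₁ ∩ C₂, ∀ k, ‖x (k + 1) - w‖ ≤ ‖x k - w‖ := by
    intro w hw k
    have a := proj_sq (i₂ (x k) w hw.2)
    have b := proj_sq (i₁ (P₂ (x k)) w hw.1)
    rw [hiter]
    apply le_of_sq_aux _ (norm_nonneg _)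
    nlinarith [sq_nonneg ‖x k - P₂ (x k)‖, sq_nonneg ‖P₂ (x k) - P₁ (P₂ (x k))‖]
  have fejer : ∀ w ∈ C₁ ∩ C₂, Antitone fun k => ‖x k - w‖ :=
    fun w hw => antitone_nat_of_succ_le (fejer1 w hw)
  set r := ‖x 0 - xbar‖ with hr
  have hr0 : 0 ≤ r := norm_nonneg _
  set c := r / R with hc
  have hc0 : 0 ≤ c := by positivity
  have hM2 : M' = 1 / (8 * (1 + 2 * c) ^ 2) := by
    rw [hM', zpow_neg]
    have : 2 * r / R = 2 * c := by rw [hc]; ring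
    rw [this]
    norm_cast
    field_simp
  have hMpos : 0 < M' := by rw [hM2]; positivity
  have hnear : ∀ k, ∃ w ∈ C₁ ∩ C₂, ‖x k - w‖ ≤ c * ‖x k - P₂ (x k)‖ := by
    intro k
    obtain ⟨w, hw, h⟩ := exists_near hconv₁ hconv₂ hR hball (hmem k) (hP₂ (x k)).1
    refine ⟨w, hw, h.trans ?_⟩
    have : ‖x k - xbar‖ ≤ r := fejer xbar hxb (Nat.zero_le k)
    rw [hc]; gcongr
  have hMc : M' / 4 ≤ 1 / (1 + c) ^ 2 := by
    have : M' ≤ 1 / (1 + c) ^ 2 := by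
      rw [hM2]
      apply one_div_le_one_div_of_le (by positivity)
      nlinarith
    linarith
  set s := Real.sqrt (1 + M' / 4) with hs
  have hs2 : s ^ 2 = 1 + M' / 4 := Real.sq_sqrt (by positivity)
  have hs1 : 1 < s := by
    rw [hs, Real.lt_sqrt (by norm_num)]; linarith
  have hspos : 0 < s := by linarith
  have step : ∀ k, infDist (x (k + 1)) C₂ * s ≤ infDist (x k) C₂ := by
    intro k
    obtain ⟨w, hw, h⟩ := hnear k
    have a := contract (p := P₁ (P₂ (x k))) hc0 h (i₂ _ w hw.2) (i₁ _ w hw.1) (i₁ _ _ (hmem k))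
    have b : infDist (x (k + 1)) C₂ ≤ ‖P₂ (x k) - P₁ (P₂ (x k))‖ := by
      rw [norm_sub_rev, ← hiter, ← dist_eq_norm]
      exact infDist_le_dist_of_mem (hP₂ _).1
    have b2 : infDist (x (k + 1)) C₂ ^ 2 ≤ ‖P₂ (x k) - P₁ (P₂ (x k))‖ ^ 2 := by
      gcongr
      exact infDist_nonneg
    apply le_of_sq_aux _ infDist_nonneg
    rw [mul_pow, hs2, hdist (x k)]
    have c1 : (1 - 1 / (1 + c) ^ 2) * (1 + M' / 4) ≤ 1 := by
      have : 0 < 1 / (1 + c) ^ 2 := by positivity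
      nlinarith
    calc _ ≤ ((1 - 1 / (1 + c) ^ 2) * ‖x k - P₂ (x k)‖ ^ 2) * (1 + M' / 4) := by
            gcongr; exact b2.trans a
      _ = ((1 - 1 / (1 + c) ^ 2) * (1 + M' / 4)) * ‖x k - P₂ (x k)‖ ^ 2 := by ring
      _ ≤ 1 * ‖x k - P₂ (x k)‖ ^ 2 := by gcongr
      _ = _ := one_mul _
  have decay : ∀ k, infDist (x k) C₂ ≤ infDist (x 0) C₂ / s ^ k := by
    intro k
    induction k with
    | zero => simp
    | succ k ih =>
      rw [pow_succ, ← div_div, le_div_iff₀ hspos]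
      exact (step k).trans ih
  have hgap : ∀ k, dist (x k) (x (k + 1)) ≤ infDist (x 0) C₂ * s⁻¹ ^ k := by
    intro k
    have a := proj_sq (i₁ (P₂ (x k)) _ (hmem k))
    have : ‖P₁ (P₂ (x k)) - x k‖ ≤ ‖P₂ (x k) - x k‖ := by
      apply le_of_sq_aux _ (norm_nonneg _)
      nlinarith [sq_nonneg ‖P₂ (x k) - P₁ (P₂ (x k))‖]
    rw [dist_comm, dist_eq_norm, hiter]
    refine this.trans ?_
    rw [norm_sub_rev, ← hdist, inv_pow, ← div_eq_mul_inv]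
    exact decay k
  have hcau := cauchySeq_of_le_geometric _ _ (inv_lt_one_of_one_lt₀ hs1) hgap
  obtain ⟨xs, hxs⟩ := cauchySeq_tendsto_of_complete hcau
  have hxs1 : xs ∈ C₁ := hclosed₁.mem_of_tendsto hxs (Eventually.of_forall hmem)
  have hxs2 : xs ∈ C₂ := by
    rw [hclosed₂.mem_iff_infDist_zero ⟨xbar, hxb.2⟩]
    have t1 : Tendsto (fun k => infDist (x k) C₂) atTop (nhds (infDist xs C₂)) :=
      ((continuous_infDist_pt C₂).tendsto xs).comp hxs
    have t2 : Tendsto (fun k => infDist (x k) C₂) atTop (nhds 0) := by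
      refine squeeze_zero (fun _ => infDist_nonneg) decay ?_
      have := (tendsto_pow_atTop_nhds_zero_of_lt_one (inv_nonneg.2 hspos.le)
        (inv_lt_one_of_one_lt₀ hs1)).const_mul (infDist (x 0) C₂)
      simpa [div_eq_mul_inv] using this
    exact tendsto_nhds_unique t1 t2
  have hQ : 0 ≤ 1 + M' / 4 := by positivity
  refine ⟨hmem, xs, ⟨hxs1, hxs2⟩, hxs, ?_, ?_⟩
  · intro k
    rw [Real.rpow_div_two_eq_sqrt _ hQ, Real.rpow_natCast]
    exact decay k
  · intro k hk
    obtain ⟨j, rfl⟩ := Nat.exists_eq_add_of_le' hk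
    have : ((j + 1 : ℕ) : ℝ) - 1 = (j : ℝ) := by push_cast; ring
    rw [this, Real.rpow_div_two_eq_sqrt _ hQ, Real.rpow_natCast, ← hs]
    obtain ⟨w, hw, h⟩ := hnear (j + 1)
    have l1 : ‖xs - w‖ ≤ ‖x (j + 1) - w‖ := by
      refine le_of_tendsto (hxs.sub_const w).norm ?_
      filter_upwards [eventually_ge_atTop (j + 1)] with i hi
      exact fejer w hw hi
    have l2 : ‖x (j + 1) - xs‖ ≤ ‖x (j + 1) - w‖ + ‖xs - w‖ := by
      rw [norm_sub_rev xs w]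
      exact norm_sub_le_norm_sub_add_norm_sub _ _ _
    have l3 : ‖x (j + 1) - P₂ (x (j + 1))‖ ≤ infDist (x 0) C₂ / s ^ j := by
      rw [← hdist]
      refine (decay (j + 1)).trans ?_
      gcongr
      · exact infDist_nonneg
      · exact hs1.le
      · exact Nat.le_succ j
    have l4 : 2 * c ≤ 1 + 8 / (M' * Real.sqrt (1 + 4 / M')) := by
      set u := 1 + 2 * c with hu
      have hu1 : 1 ≤ u := by linarith
      have hsq : Real.sqrt (1 + 4 / M') ≤ 6 * u := by
        rw [Real.sqrt_le_left (by positivity), hM2]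
        have : 4 / (1 / (8 * u ^ 2)) = 32 * u ^ 2 := by field_simp; norm_num
        rw [this]; nlinarith
      have hsp : 0 < Real.sqrt (1 + 4 / M') := Real.sqrt_pos.2 (by positivity)
      have : u ≤ 8 / (M' * Real.sqrt (1 + 4 / M')) := by
        rw [le_div_iff₀ (by positivity)]
        calc u * (M' * Real.sqrt (1 + 4 / M')) ≤ u * (M' * (6 * u)) := by gcongr
          _ = 6 / 8 := by rw [hM2]; field_simp
          _ ≤ 8 := by norm_num
      linarith
    calc ‖x (j + 1) - xs‖ ≤ 2 * c * ‖x (j + 1) - P₂ (x (j + 1))‖ := by linarith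
      _ ≤ (1 + 8 / (M' * Real.sqrt (1 + 4 / M'))) * (infDist (x 0) C₂ / s ^ j) := by
          gcongr
      _ = _ := by rw [mul_div_assoc]
end
end

section
/- Linear complexity bounds for ISTA (Theorem 5.3): let A be a real m×n matrix, d ∈ ℝ^m, μ > 0, and f : ℝⁿ → ℝ, f(x) = μ‖x‖₁ + ½‖Ax − d‖₂²; let L = ‖AᵀA‖ (operator norm) and let 0 < λ⁻ ≤ λ_k ≤ λ⁺ < 2/L. From x₀ ∈ ℝⁿ, define the ISTA sequence by letting x_{k+1} be the unique minimizer over z ∈ ℝⁿ of μ‖z‖₁ + (1/(2λ_k))‖z − (x_k − λ_k(AᵀA x_k − Aᵀd))‖₂², and set a = 1/λ⁺ − L/2, b = 1/λ⁻ + L. Then there exists γ > 0 such that, with q = 1 + 2aγ/b² and Cq = (1/√a)·(1 + 1/((aγ/b²)·√(1 + b²/(2aγ)))), the sequence (x_k) converges to some minimizer x* of f and: f(x_k) − min f ≤ (f(x₀) − min f)/q^k for all k ≥ 0, and ‖x_k − x*‖ ≤ Cq·√(f(x₀) − min f) / q^{(k−1)/2} for all k ≥ 1. -/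
open Metric Set Filter
open scoped Matrix

noncomputable section


/-- Kernel-injectivity bound in finite dimension. -/
lemma aux_bound {E F : Type*} [NormedAddCommGroup E] [InnerProductSpace ℝ E]
    [FiniteDimensional ℝ E] [NormedAddCommGroup F] [InnerProductSpace ℝ F]
    [FiniteDimensional ℝ F] (B : E →L[ℝ] F) :
    ∃ C : ℝ, 0 ≤ C ∧ ∀ v, ‖B v‖ ≤ C * ‖B.adjoint (B v)‖ := by
  let g : (LinearMap.range (B : E →ₗ[ℝ] F)) →ₗ[ℝ] E :=
    (B.adjoint : F →ₗ[ℝ] E).domRestrict _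
  have hg : LinearMap.ker g = ⊥ := by
    rw [LinearMap.ker_eq_bot']
    rintro ⟨y, v, rfl⟩ h
    have h' : B.adjoint (B v) = 0 := h
    have : inner ℝ (B v) (B v) = 0 := by
      rw [← ContinuousLinearMap.adjoint_inner_left, h', inner_zero_left]
    have h0 : B v = 0 := inner_self_eq_zero.1 this
    exact Subtype.ext h0
  obtain ⟨K, hK, hl⟩ := g.exists_antilipschitzWith hg
  refine ⟨K, K.2, fun v => ?_⟩
  have := hl.le_mul_dist ⟨B v, v, rfl⟩ 0
  simpa [g] using this

lemma aux_prox {E : Type*} [NormedAddCommGroup E] [InnerProductSpace ℝ E]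
    (N : E → ℝ) (hN : ∀ x z : E, ∀ t : ℝ, 0 ≤ t → t ≤ 1 →
      N (x + t • (z - x)) ≤ (1 - t) * N x + t * N z)
    (l : ℝ) (hl : 0 < l) (x p : E)
    (h : ∀ z, N x + 1 / (2 * l) * ‖x - p‖ ^ 2 ≤ N z + 1 / (2 * l) * ‖z - p‖ ^ 2) (z : E) :
    N x + inner ℝ (l⁻¹ • (p - x)) (z - x) ≤ N z := by
  have key : ∀ t : ℝ, 0 < t → t ≤ 1 →
      N x + inner ℝ (l⁻¹ • (p - x)) (z - x) - N z ≤ t * (1 / (2 * l) * ‖z - x‖ ^ 2) := by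
    intro t ht ht1
    have h1 := h (x + t • (z - x))
    have h2 := hN x z t ht.le ht1
    have e : x + t • (z - x) - p = t • (z - x) - (p - x) := by abel
    have e2 : ‖x - p‖ ^ 2 = ‖p - x‖ ^ 2 := by rw [norm_sub_rev]
    rw [e, norm_sub_sq_real (t • (z - x)) (p - x), norm_smul, inner_smul_left, e2, mul_pow] at h1
    rw [inner_smul_left, real_inner_comm]
    simp only [Real.norm_eq_abs, sq_abs, conj_trivial] at h1 ⊢
    set I : ℝ := inner ℝ (z - x) (p - x)
    set n1 := ‖z - x‖ ^ 2
    set n2 := ‖p - x‖ ^ 2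
    have e3 : 1 / (2 * l) * (t ^ 2 * n1 - 2 * (t * I) + n2)
      = t * (t * (1 / (2 * l) * n1)) - t * (l⁻¹ * I) + 1 / (2 * l) * n2 := by
      field_simp
    rw [e3] at h1
    have : t * (N x + l⁻¹ * I - N z) ≤ t * (t * (1 / (2 * l) * n1)) := by nlinarith
    exact le_of_mul_le_mul_left this ht
  by_contra hc
  push Not at hc
  set D := N x + inner ℝ (l⁻¹ • (p - x)) (z - x) - N z with hD
  have hDp : 0 < D := by linarith
  set M := 1 / (2 * l) * ‖z - x‖ ^ 2 with hM
  have hM0 : 0 ≤ M := by positivity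
  have := key (min 1 (D / (2 * (M + 1)))) (by positivity) (min_le_left _ _)
  have h3 : min 1 (D / (2 * (M + 1))) * M ≤ D / (2 * (M + 1)) * M :=
    mul_le_mul_of_nonneg_right (min_le_right _ _) hM0
  have h4 : D / (2 * (M + 1)) * M < D := by
    rw [div_mul_eq_mul_div, div_lt_iff₀ (by positivity)]
    nlinarith
  linarith

lemma aux_sub {n : ℕ} (μ : ℝ) (x u : EuclideanSpace ℝ (Fin n))
    (h : ∀ z : EuclideanSpace ℝ (Fin n),
      μ * ∑ i, |x i| + inner ℝ u (z - x) ≤ μ * ∑ i, |z i|) (i : Fin n) (hi : x i ≠ 0) :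
    u i = μ * (SignType.sign (x i) : ℝ) := by
  have key : ∀ t : ℝ, μ * |x i| + u i * t ≤ μ * |x i + t| := by
    intro t
    have h1 := h (x + EuclideanSpace.single i t)
    rw [add_sub_cancel_left, EuclideanSpace.inner_single_right] at h1
    have e : ∑ j, |(x + EuclideanSpace.single i t) j| = ∑ j, |x j| - |x i| + |x i + t| := by
      rw [← Finset.add_sum_erase _ _ (Finset.mem_univ i),
        ← Finset.add_sum_erase (a := i) _ (fun j => |x j|) (Finset.mem_univ i)]
      have : ∑ j ∈ Finset.univ.erase i, |(x + EuclideanSpace.single i t) j|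
          = ∑ j ∈ Finset.univ.erase i, |x j| := by
        refine Finset.sum_congr rfl fun j hj => ?_
        have := Finset.ne_of_mem_erase hj
        simp [this]
      rw [this]
      simp
      ring
    rw [e] at h1
    simp at h1
    linarith
  have h1 := key (x i)
  have h2 := key (-x i)
  have e : |x i + x i| = 2 * |x i| := by rw [← two_mul, abs_mul]; simp
  rw [e] at h1
  simp at h2
  have h3 : u i * x i = μ * |x i| := by linarith
  rw [← self_mul_sign] at h3
  apply mul_right_cancel₀ hi
  linarith

lemma aux_l1 {n : ℕ} (μ : ℝ) (hμ : 0 < μ) (x z : EuclideanSpace ℝ (Fin n)) (t : ℝ)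
    (ht : 0 ≤ t) (ht1 : t ≤ 1) :
    μ * ∑ i, |(x + t • (z - x)) i| ≤ (1 - t) * (μ * ∑ i, |x i|) + t * (μ * ∑ i, |z i|) := by
  have : ∑ i, |(x + t • (z - x)) i| ≤ (1 - t) * ∑ i, |x i| + t * ∑ i, |z i| := by
    rw [Finset.mul_sum, Finset.mul_sum, ← Finset.sum_add_distrib]
    refine Finset.sum_le_sum fun i _ => ?_
    have : (x + t • (z - x)) i = (1 - t) * x i + t * z i := by simp; ring
    rw [this]
    refine (abs_add_le _ _).trans ?_
    rw [abs_mul, abs_mul, abs_of_nonneg ht, abs_of_nonneg (by linarith : 0 ≤ 1 - t)]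
  nlinarith

/-- Final bookkeeping. -/
lemma aux_final {E : Type*} [NormedAddCommGroup E] (x : ℕ → E) (xs : E) (r : ℕ → ℝ)
    (a b C : ℝ) (ha : 0 < a) (hb : 0 < b) (hC : 0 < C) (hr : ∀ k, 0 ≤ r k)
    (h1 : ∀ k, a * ‖x (k + 1) - x k‖ ^ 2 ≤ r k - r (k + 1))
    (h2 : ∀ k, r (k + 1) ≤ C * ‖x (k + 1) - x k‖ ^ 2)
    (hsub : ∃ φ : ℕ → ℕ, Tendsto φ atTop atTop ∧ Tendsto (x ∘ φ) atTop (nhds xs)) :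
    ∃ γ : ℝ, 0 < γ ∧ Tendsto x atTop (nhds xs) ∧
        (∀ k : ℕ, r k ≤ r 0 / (1 + 2 * a * γ / b ^ 2) ^ k) ∧
        ∀ k : ℕ, 1 ≤ k → ‖x k - xs‖ ≤
          ((1 / Real.sqrt a) *
              (1 + 1 / ((a * γ / b ^ 2) * Real.sqrt (1 + b ^ 2 / (2 * a * γ))))) *
            Real.sqrt (r 0) /
              (1 + 2 * a * γ / b ^ 2) ^ (((k : ℝ) - 1) / 2) := by
  set Q := 1 + a / C with hQ
  have hQ1 : 1 < Q := by have : 0 < a / C := by positivity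
                         linarith
  have hQ0 : 0 < Q := by linarith
  have hstep : ∀ k, r (k + 1) ≤ r k / Q := by
    intro k
    rw [le_div_iff₀ hQ0, hQ]
    have e : r (k + 1) * (a / C) ≤ a * ‖x (k + 1) - x k‖ ^ 2 := by
      have := mul_le_mul_of_nonneg_right (h2 k) (by positivity : 0 ≤ a / C)
      refine this.trans (le_of_eq ?_)
      field_simp
    nlinarith [h1 k]
  have hrate : ∀ k, r k ≤ r 0 / Q ^ k := by
    intro k
    induction k with
    | zero => simp
    | succ k ih =>
      refine (hstep k).trans ?_
      rw [pow_succ, ← div_div]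
      gcongr
  set S := Real.sqrt Q with hS
  have hS1 : 1 < S := by rw [hS]; exact Real.lt_sqrt_of_sq_lt (by simpa using hQ1)
  have hS0 : 0 < S := by linarith
  have hSQ : S ^ 2 = Q := Real.sq_sqrt hQ0.le
  set ρ := S⁻¹ with hρ
  have hρ1 : ρ < 1 := inv_lt_one_of_one_lt₀ hS1
  have hρ0 : 0 < ρ := by positivity
  set K := 1 / Real.sqrt a * Real.sqrt (r 0) with hK
  have hsa : 0 < Real.sqrt a := Real.sqrt_pos.2 ha
  have hK0 : 0 ≤ K := by positivity
  have hd : ∀ k, dist (x k) (x (k + 1)) ≤ K * ρ ^ k := by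
    intro k
    rw [dist_comm, dist_eq_norm]
    refine (pow_le_pow_iff_left₀ (norm_nonneg _) (by positivity) two_ne_zero).1 ?_
    have e : (K * ρ ^ k) ^ 2 = r 0 / Q ^ k / a := by
      rw [hK, hρ, mul_pow, mul_pow, Real.sq_sqrt (hr 0), div_pow, Real.sq_sqrt ha.le, ← pow_mul,
        mul_comm k 2, pow_mul, inv_pow, hSQ, inv_pow]
      field_simp
    rw [e, le_div_iff₀ ha]
    have := h1 k
    have := hr (k + 1)
    have := hrate k
    linarith
  have hc : CauchySeq x := cauchySeq_of_le_geometric ρ K hρ1 hd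
  obtain ⟨φ, hφ, hφx⟩ := hsub
  have hx : Tendsto x atTop (nhds xs) := tendsto_nhds_of_cauchySeq_of_subseq hc hφ hφx
  have hdist : ∀ k, ‖x k - xs‖ ≤ K * ρ ^ k / (1 - ρ) := by
    intro k
    rw [← dist_eq_norm]
    exact dist_le_of_le_geometric_of_tendsto ρ K hρ1 hd hx k
  set D := 1 - ρ with hD
  have hD0 : 0 < D := by linarith
  obtain ⟨t, ht0, ht1, ht2, ht3⟩ : ∃ t : ℝ, 0 < t ∧ t ≤ 1 / 2 ∧ 1 + 2 * t ≤ Q ∧ t ≤ D ^ 2 := by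
    refine ⟨min (1 / 2) (min ((Q - 1) / 2) (D ^ 2)), ?_, ?_, ?_, ?_⟩
    · have : 0 < (Q - 1) / 2 := by linarith
      positivity
    · exact min_le_left _ _
    · have : min (1 / 2) (min ((Q - 1) / 2) (D ^ 2)) ≤ (Q - 1) / 2 :=
        (min_le_right _ _).trans (min_le_left _ _)
      linarith
    · exact (min_le_right _ _).trans (min_le_right _ _)
  have e1 : 1 + 2 * a * (t * b ^ 2 / a) / b ^ 2 = 1 + 2 * t := by field_simp
  have e2 : a * (t * b ^ 2 / a) / b ^ 2 = t := by field_simp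
  have e3 : b ^ 2 / (2 * a * (t * b ^ 2 / a)) = 1 / (2 * t) := by field_simp
  refine ⟨t * b ^ 2 / a, by positivity, hx, ?_, ?_⟩
  · intro k
    rw [e1]
    refine (hrate k).trans ?_
    have := hr 0
    gcongr
  · intro k hk
    rw [e1, e2, e3]
    refine (hdist k).trans ?_
    have hs : t * Real.sqrt (1 + 1 / (2 * t)) ≤ D := by
      rw [← le_div_iff₀' ht0]
      apply Real.sqrt_le_iff.2 ⟨by positivity, ?_⟩
      rw [div_pow, le_div_iff₀ (by positivity)]
      have : (1 + 1 / (2 * t)) * t ^ 2 = t ^ 2 + t / 2 := by field_simp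
      nlinarith
    have hs0 : 0 < t * Real.sqrt (1 + 1 / (2 * t)) := by positivity
    have h3 : 1 / D ≤ 1 + 1 / (t * Real.sqrt (1 + 1 / (2 * t))) := by
      have := one_div_le_one_div_of_le hs0 hs
      linarith
    have h4 : (1 + 2 * t) ^ (((k : ℝ) - 1) / 2) ≤ S ^ k := by
      have e : S ^ k = Q ^ ((k : ℝ) / 2) := by
        rw [hS, Real.sqrt_eq_rpow, ← Real.rpow_natCast, ← Real.rpow_mul hQ0.le]
        congr 1; ring
      rw [e]
      have hk1 : (1 : ℝ) ≤ k := by exact_mod_cast hk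
      calc (1 + 2 * t) ^ (((k : ℝ) - 1) / 2) ≤ Q ^ (((k : ℝ) - 1) / 2) :=
            Real.rpow_le_rpow (by positivity) ht2 (by linarith)
        _ ≤ _ := Real.rpow_le_rpow_of_exponent_le hQ1.le (by linarith)
    have h5 : 0 < (1 + 2 * t) ^ (((k : ℝ) - 1) / 2) := by positivity
    calc K * ρ ^ k / D = K * (1 / D) / S ^ k := by rw [hρ, inv_pow]; field_simp
      _ ≤ K * (1 + 1 / (t * Real.sqrt (1 + 1 / (2 * t)))) / (1 + 2 * t) ^ (((k : ℝ) - 1) / 2) := by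
        gcongr
      _ = _ := by rw [hK]; ring

lemma aux_quad {E F : Type*} [NormedAddCommGroup E] [InnerProductSpace ℝ E]
    [FiniteDimensional ℝ E] [NormedAddCommGroup F] [InnerProductSpace ℝ F]
    [FiniteDimensional ℝ F] (T : E →L[ℝ] F) (d : F) (x z : E) :
    1 / 2 * ‖T z - d‖ ^ 2 = 1 / 2 * ‖T x - d‖ ^ 2
      + inner ℝ (T.adjoint (T x - d)) (z - x) + 1 / 2 * ‖T (z - x)‖ ^ 2 := by
  have e : T z - d = (T x - d) + T (z - x) := by rw [map_sub]; abel
  rw [e, norm_add_sq_real, ContinuousLinearMap.adjoint_inner_left]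
  ring

lemma aux_core {n : ℕ} {F : Type*} [NormedAddCommGroup F] [InnerProductSpace ℝ F]
    [FiniteDimensional ℝ F] (T : EuclideanSpace ℝ (Fin n) →L[ℝ] F) (d : F) (μ : ℝ)
    (f : EuclideanSpace ℝ (Fin n) → ℝ)
    (hf : ∀ x, f x = μ * ∑ i, |x i| + (1 / 2) * ‖T x - d‖ ^ 2)
    (y u w : ℕ → EuclideanSpace ℝ (Fin n))
    (hu : ∀ k z, μ * ∑ i, |y k i| + inner ℝ (u k) (z - y k) ≤ μ * ∑ i, |z i|)
    (hw : ∀ k, w k = u k + T.adjoint (T (y k) - d))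
    (hw0 : Tendsto w atTop (nhds 0)) (R : ℝ) (hR : ∀ k, ‖y k‖ ≤ R) :
    ∃ xs, (∀ z, f xs ≤ f z) ∧ (∃ φ : ℕ → ℕ, Tendsto φ atTop atTop ∧
      Tendsto (y ∘ φ) atTop (nhds xs)) ∧
      ∃ C : ℝ, 0 < C ∧ ∀ k, f (y k) - f xs ≤ C * ‖w k‖ ^ 2 := by
  have hsg : ∀ k z, f (y k) + inner ℝ (w k) (z - y k) ≤ f z := by
    intro k z
    rw [hf, hf, aux_quad T d (y k) z, hw, inner_add_left]
    have := hu k z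
    have : 0 ≤ ‖T (z - y k)‖ ^ 2 := by positivity
    linarith
  have hfc : Continuous f := by
    have : f = fun x => μ * ∑ i, |x i| + (1 / 2) * ‖T x - d‖ ^ 2 := funext hf
    rw [this]
    fun_prop
  have hlim : ∀ φ : ℕ → ℕ, Tendsto φ atTop atTop → ∀ p, Tendsto (y ∘ φ) atTop (nhds p) →
      ∀ z, f p ≤ f z := by
    intro φ hφ p hp z
    have h1 : Tendsto (fun k => f (y (φ k)) + inner ℝ (w (φ k)) (z - y (φ k))) atTop
        (nhds (f p + inner ℝ (0 : EuclideanSpace ℝ (Fin n)) (z - p))) := by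
      refine Tendsto.add ((hfc.tendsto p).comp hp) ?_
      exact Tendsto.inner (hw0.comp hφ) (tendsto_const_nhds.sub hp)
    rw [inner_zero_left, add_zero] at h1
    exact le_of_tendsto h1 (Eventually.of_forall fun k => hsg _ z)
  have hsubs : ∀ ψ : ℕ → ℕ, StrictMono ψ → ∃ p, ∃ φ : ℕ → ℕ, StrictMono φ ∧
      Tendsto (y ∘ ψ ∘ φ) atTop (nhds p) := by
    intro ψ hψ
    obtain ⟨p, -, φ, hφ, h⟩ := tendsto_subseq_of_bounded
      (Metric.isBounded_closedBall (x := (0 : EuclideanSpace ℝ (Fin n))) (r := R))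
      (x := y ∘ ψ) (fun k => by simpa using hR _)
    exact ⟨p, φ, hφ, h⟩
  obtain ⟨xs, φ, hφ, hφx⟩ := hsubs id strictMono_id
  have hmin := hlim φ hφ.tendsto_atTop xs hφx
  refine ⟨xs, hmin, ⟨φ, hφ.tendsto_atTop, hφx⟩, ?_⟩
  -- each sign pattern
  have hpat : ∀ σ : Fin n → SignType, ∃ C : ℝ, 0 < C ∧
      ∀ k, (∀ i, SignType.sign (y k i) = σ i) → f (y k) - f xs ≤ C * ‖w k‖ ^ 2 := by
    intro σ
    by_cases hfin : {k | ∀ i, SignType.sign (y k i) = σ i}.Finite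
    · have hk : ∀ k, ∃ C : ℝ, f (y k) - f xs ≤ C * ‖w k‖ ^ 2 := by
        intro k
        by_cases h0 : w k = 0
        · refine ⟨0, ?_⟩
          have := hsg k xs
          rw [h0, inner_zero_left] at this
          linarith
        · refine ⟨(f (y k) - f xs) / ‖w k‖ ^ 2, ?_⟩
          have : ‖w k‖ ≠ 0 := by simpa using h0
          rw [div_mul_cancel₀]
          positivity
      choose c hc using hk
      obtain ⟨M, hM⟩ := (hfin.image c).bddAbove
      refine ⟨max M 1, by positivity, fun k hk => (hc k).trans ?_⟩
      have : c k ≤ max M 1 := (hM ⟨k, hk, rfl⟩).trans (le_max_left _ _)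
      gcongr
    · have hinf : ∃ᶠ k in atTop, ∀ i, SignType.sign (y k i) = σ i :=
        Nat.frequently_atTop_iff_infinite.2 hfin
      obtain ⟨ψ, hψ, hψσ⟩ := extraction_of_frequently_atTop hinf
      obtain ⟨p, θ, hθ, hp⟩ := hsubs ψ hψ
      have hψθ : Tendsto (ψ ∘ θ) atTop atTop := (hψ.comp hθ).tendsto_atTop
      have hpmin := hlim (ψ ∘ θ) hψθ p hp
      have hfp : f xs = f p := le_antisymm (hmin p) (hpmin xs)
      -- the mask
      let s : Fin n → ℝ := fun i => (σ i : ℝ)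
      let P : EuclideanSpace ℝ (Fin n) →L[ℝ] EuclideanSpace ℝ (Fin n) :=
        LinearMap.toContinuousLinearMap
          (Matrix.toEuclideanLin (Matrix.diagonal fun i => s i ^ 2))
      have hP : ∀ v i, P v i = s i ^ 2 * v i := by
        intro v i
        simp [P, Matrix.toEuclideanLin_apply, Matrix.mulVec_diagonal]
      have hs : ∀ i, s i = 0 ∨ s i = 1 ∨ s i = -1 := by
        intro i
        simp only [s]
        cases σ i <;> simp
      have hPself : ∀ v z, inner ℝ (P v) z = inner ℝ v (P z) := by
        intro v z
        simp only [PiLp.inner_apply, hP]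
        refine Finset.sum_congr rfl fun i _ => ?_
        simp; ring
      have hPnorm : ∀ v, ‖P v‖ ≤ ‖v‖ := by
        intro v
        rw [EuclideanSpace.norm_eq, EuclideanSpace.norm_eq]
        apply Real.sqrt_le_sqrt
        refine Finset.sum_le_sum fun i _ => ?_
        rw [hP]
        rcases hs i with h | h | h <;> simp [h]
        positivity
      let c : EuclideanSpace ℝ (Fin n) := WithLp.toLp 2 fun i => μ * s i
      -- facts for points of the pattern
      have hyP : ∀ k, (∀ i, SignType.sign (y k i) = σ i) → P (y k) = y k := by
        intro k hk
        ext i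
        rw [hP]
        simp only [s, ← hk i]
        rcases lt_trichotomy (y k i) 0 with h | h | h <;> simp [h]
      have hyabs : ∀ k, (∀ i, SignType.sign (y k i) = σ i) →
          μ * ∑ i, |y k i| = inner ℝ c (y k) := by
        intro k hk
        simp only [PiLp.inner_apply, Finset.mul_sum]
        refine Finset.sum_congr rfl fun i _ => ?_
        have e := self_mul_sign (y k i)
        simp only [c, s, ← hk i]
        simp
        rw [← e]
        ring
      have hyG : ∀ k, (∀ i, SignType.sign (y k i) = σ i) →
          P (w k) = c + P (T.adjoint (T (y k) - d)) := by
        intro k hk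
        rw [hw, map_add]
        congr 1
        ext i
        rw [hP]
        by_cases h0 : y k i = 0
        · have : s i = 0 := by simp [s, ← hk i, h0]
          simp [c, this]
        · rw [aux_sub μ (y k) (u k) (hu k) i h0, hk i]
          change s i ^ 2 * (μ * s i) = μ * s i
          rcases hs i with h | h | h <;> simp [h]
      have hσθ : ∀ j, ∀ i, SignType.sign (y (ψ (θ j)) i) = σ i := fun j => hψσ _
      have hpP : P p = p := by
        have h1 : Tendsto (fun j => P (y (ψ (θ j)))) atTop (nhds (P p)) :=
          (P.continuous.tendsto p).comp hp
        refine tendsto_nhds_unique h1 (hp.congr fun j => ?_)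
        exact (hyP _ (hσθ j)).symm
      have hpabs : μ * ∑ i, |p i| = inner ℝ c p := by
        have hc1 : Continuous fun v : EuclideanSpace ℝ (Fin n) => μ * ∑ i, |v i| := by fun_prop
        have hc2 : Continuous fun v : EuclideanSpace ℝ (Fin n) => (inner ℝ c v : ℝ) := by fun_prop
        refine tendsto_nhds_unique ((hc1.tendsto p).comp hp)
          (((hc2.tendsto p).comp hp).congr fun j => ?_)
        exact (hyabs _ (hσθ j)).symm
      have hpG : c + P (T.adjoint (T p - d)) = 0 := by
        have hc1 : Continuous fun v => c + P (T.adjoint (T v - d)) := by fun_prop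
        have h2 : Tendsto (fun j => P (w (ψ (θ j)))) atTop (nhds 0) := by
          have := (P.continuous.tendsto 0).comp (hw0.comp hψθ)
          rw [map_zero] at this
          exact this
        refine tendsto_nhds_unique ((hc1.tendsto p).comp hp) (h2.congr fun j => ?_)
        exact hyG _ (hσθ j)
      obtain ⟨K, hK0, hK⟩ := aux_bound (T.comp P)
      have hBadj : ∀ v, (T.comp P).adjoint v = P (T.adjoint v) := by
        intro v
        refine ext_inner_right ℝ fun z => ?_
        rw [ContinuousLinearMap.adjoint_inner_left, hPself,
          ContinuousLinearMap.adjoint_inner_left]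
        rfl
      refine ⟨1 / 2 * K ^ 2 + 1, by positivity, fun k hk => ?_⟩
      set v := y k - p with hv
      have hPv : P v = v := by rw [hv, map_sub, hyP k hk, hpP]
      have h1 : f (y k) - f xs = 1 / 2 * ‖T v‖ ^ 2 := by
        rw [hfp, hf, hf, aux_quad T d p (y k), hyabs k hk, hpabs]
        have e : inner ℝ c v + inner ℝ (T.adjoint (T p - d)) v = (0 : ℝ) := by
          have : inner ℝ (T.adjoint (T p - d)) v = (inner ℝ (P (T.adjoint (T p - d))) v : ℝ) := by
            rw [hPself, hPv]
          rw [this, ← inner_add_left, hpG, inner_zero_left]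
        have e2 : (inner ℝ c v : ℝ) = inner ℝ c (y k) - inner ℝ c p := by
          rw [hv, inner_sub_right]
        linarith
      have h2 : (T.comp P).adjoint ((T.comp P) v) = P (w k) := by
        rw [hBadj, ← sub_zero (P (w k)), ← hpG, hyG k hk]
        simp only [ContinuousLinearMap.comp_apply, hPv, add_sub_add_left_eq_sub, ← map_sub]
        congr 2
        rw [hv, map_sub]
        abel
      have h3 : ‖T v‖ ≤ K * ‖w k‖ := by
        have := hK v
        rw [h2, ContinuousLinearMap.comp_apply, hPv] at this
        exact this.trans (mul_le_mul_of_nonneg_left (hPnorm _) hK0)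
      rw [h1]
      have h4 : ‖T v‖ ^ 2 ≤ (K * ‖w k‖) ^ 2 := by gcongr
      nlinarith [sq_nonneg ‖w k‖]
  choose C hC0 hC using hpat
  refine ⟨∑ σ, C σ, Finset.sum_pos (fun σ _ => hC0 σ) ⟨fun _ => 0, Finset.mem_univ _⟩,
    fun k => ?_⟩
  refine (hC (fun i => SignType.sign (y k i)) k fun i => rfl).trans ?_
  gcongr
  exact Finset.single_le_sum (f := C) (fun σ _ => (hC0 σ).le) (Finset.mem_univ _)

/-- **Theorem 5.3** (linear complexity bounds for ISTA): for
`f(x) = μ‖x‖₁ + ½‖Ax − d‖₂²`, `L = ‖AᵀA‖` (operator norm),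
steps `0 < λ⁻ ≤ λ_k ≤ λ⁺ < 2/L`, and the ISTA iterates
`x_{k+1} = argmin_z μ‖z‖₁ + ‖z − (x_k − λ_k(AᵀA x_k − Aᵀd))‖²/(2λ_k)`,
with `a = 1/λ⁺ − L/2` and `b = 1/λ⁻ + L`, there exists `γ > 0` such that, with
`q = 1 + 2aγ/b²` and `C_q = (1/√a)(1 + 1/((aγ/b²)√(1 + b²/(2aγ))))`, the
sequence converges to a minimizer `x*` of `f`,
`f(x_k) − min f ≤ (f(x₀) − min f)/q^k` for all `k ≥ 0`, and
`‖x_k − x*‖ ≤ C_q·√(f(x₀) − min f)/q^{(k−1)/2}` for all `k ≥ 1`. -/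
theorem stmt16 (m n : ℕ) (A : Matrix (Fin m) (Fin n) ℝ)
    (d : EuclideanSpace ℝ (Fin m)) (μ : ℝ) (hμ : 0 < μ)
    (f : EuclideanSpace ℝ (Fin n) → ℝ)
    (hf : ∀ x, f x = μ * ∑ i, |x i| + (1 / 2) * ‖Matrix.toEuclideanLin A x - d‖ ^ 2)
    (L : ℝ)
    (hL : L = ‖LinearMap.toContinuousLinearMap
      (Matrix.toEuclideanLin (Aᵀ * A))‖)
    (lamm lamp : ℝ) (lam : ℕ → ℝ)
    (hlamm : 0 < lamm) (hlamp : lamp < 2 / L)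
    (hlam : ∀ k, lamm ≤ lam k ∧ lam k ≤ lamp)
    (x : ℕ → EuclideanSpace ℝ (Fin n))
    (hiter : ∀ k : ℕ, ∀ z : EuclideanSpace ℝ (Fin n),
      μ * (∑ i, |x (k + 1) i|) + (1 / (2 * lam k)) *
          ‖x (k + 1) - (x k - lam k •
            (Matrix.toEuclideanLin (Aᵀ * A) (x k) - Matrix.toEuclideanLin Aᵀ d))‖ ^ 2
        ≤ μ * (∑ i, |z i|) + (1 / (2 * lam k)) *
          ‖z - (x k - lam k •
            (Matrix.toEuclideanLin (Aᵀ * A) (x k) - Matrix.toEuclideanLin Aᵀ d))‖ ^ 2)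
    (a b : ℝ) (ha : a = 1 / lamp - L / 2) (hb : b = 1 / lamm + L) :
    ∃ γ : ℝ, 0 < γ ∧
      ∃ xstar : EuclideanSpace ℝ (Fin n), (∀ y, f xstar ≤ f y) ∧
        Tendsto x atTop (nhds xstar) ∧
        (∀ k : ℕ, f (x k) - f xstar ≤
          (f (x 0) - f xstar) / (1 + 2 * a * γ / b ^ 2) ^ k) ∧
        ∀ k : ℕ, 1 ≤ k → ‖x k - xstar‖ ≤
          ((1 / Real.sqrt a) *
              (1 + 1 / ((a * γ / b ^ 2) * Real.sqrt (1 + b ^ 2 / (2 * a * γ))))) *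
            Real.sqrt (f (x 0) - f xstar) /
              (1 + 2 * a * γ / b ^ 2) ^ (((k : ℝ) - 1) / 2) := by
  classical
  set T : EuclideanSpace ℝ (Fin n) →L[ℝ] EuclideanSpace ℝ (Fin m) :=
    LinearMap.toContinuousLinearMap (Matrix.toEuclideanLin A) with hT
  have hTA : ∀ v, Matrix.toEuclideanLin A v = T v := fun v => rfl
  have hTt : ∀ v, Matrix.toEuclideanLin Aᵀ v = T.adjoint v := by
    intro v
    refine ext_inner_right ℝ fun z => ?_
    rw [ContinuousLinearMap.adjoint_inner_left, ← hTA]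
    have h := Matrix.toEuclideanLin_conjTranspose_eq_adjoint A
    rw [Matrix.conjTranspose_eq_transpose_of_trivial] at h
    rw [h, LinearMap.adjoint_inner_left]
  have hTT : ∀ v, Matrix.toEuclideanLin (Aᵀ * A) v = T.adjoint (T v) := by
    intro v
    rw [← hTt, ← hTA]
    simp [Matrix.toEuclideanLin_apply]
  have hLn : ∀ v, ‖T.adjoint (T v)‖ ≤ L * ‖v‖ := by
    intro v
    rw [← hTT, hL]
    exact (LinearMap.toContinuousLinearMap (Matrix.toEuclideanLin (Aᵀ * A))).le_opNorm v
  have hLq : ∀ v, ‖T v‖ ^ 2 ≤ L * ‖v‖ ^ 2 := by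
    intro v
    rw [← real_inner_self_eq_norm_sq, ← ContinuousLinearMap.adjoint_inner_left]
    refine (real_inner_le_norm _ _).trans ?_
    nlinarith [hLn v, norm_nonneg v]
  have hL0 : 0 ≤ L := by rw [hL]; exact norm_nonneg _
  have hlp : 0 < lamp := hlamm.trans_le ((hlam 0).1.trans (hlam 0).2)
  have hLp : 0 < L := by
    rcases hL0.eq_or_lt with h | h
    · rw [← h] at hlamp; simp at hlamp; linarith
    · exact h
  have ha0 : 0 < a := by
    rw [ha, sub_pos, lt_div_iff₀ hlp]
    rw [lt_div_iff₀ hLp] at hlamp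
    linarith
  have hb0 : 0 < b := by rw [hb]; positivity
  have hl : ∀ k, 0 < lam k := fun k => hlamm.trans_le (hlam k).1
  simp only [hTA] at hf
  simp only [hTT, hTt, ← map_sub] at hiter
  set g : EuclideanSpace ℝ (Fin n) → EuclideanSpace ℝ (Fin n) :=
    fun z => T.adjoint (T z - d) with hg
  let u : ℕ → EuclideanSpace ℝ (Fin n) :=
    fun k => (lam k)⁻¹ • ((x k - lam k • g (x k)) - x (k + 1))
  have hu : ∀ k z, μ * ∑ i, |x (k + 1) i| + inner ℝ (u k) (z - x (k + 1)) ≤ μ * ∑ i, |z i| :=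
    fun k z => aux_prox (fun v => μ * ∑ i, |v i|) (fun v z t h0 h1 => aux_l1 μ hμ v z t h0 h1)
      (lam k) (hl k) (x (k + 1)) (x k - lam k • g (x k)) (hiter k) z
  have hu2 : ∀ k, u k = (lam k)⁻¹ • (x k - x (k + 1)) - g (x k) := by
    intro k
    have : x k - lam k • g (x k) - x (k + 1) = (x k - x (k + 1)) - lam k • g (x k) := by abel
    simp only [u]
    rw [this, smul_sub, smul_smul, inv_mul_cancel₀ (hl k).ne', one_smul]
  let w : ℕ → EuclideanSpace ℝ (Fin n) := fun k => u k + g (x (k + 1))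
  have hwb : ∀ k, ‖w k‖ ≤ b * ‖x (k + 1) - x k‖ := by
    intro k
    have e : w k = (lam k)⁻¹ • (x k - x (k + 1)) + T.adjoint (T (x (k + 1) - x k)) := by
      simp only [w, hu2, hg, map_sub]
      abel
    rw [e]
    refine (norm_add_le _ _).trans ?_
    have h1 := hLn (x (k + 1) - x k)
    rw [norm_smul, norm_sub_rev (x k), Real.norm_of_nonneg (inv_nonneg.2 (hl k).le), hb, add_mul]
    have h2 : (lam k)⁻¹ ≤ 1 / lamm := by
      rw [← one_div]; exact one_div_le_one_div_of_le hlamm (hlam k).1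
    gcongr
  have hdesc : ∀ k, a * ‖x (k + 1) - x k‖ ^ 2 ≤ f (x k) - f (x (k + 1)) := by
    intro k
    rw [hf, hf, aux_quad T d (x k) (x (k + 1))]
    have h1 := hu k (x k)
    rw [hu2, inner_sub_left, inner_smul_left, real_inner_self_eq_norm_sq,
      norm_sub_rev (x k), ← neg_sub (x (k + 1)) (x k), inner_neg_right] at h1
    simp only [conj_trivial] at h1
    have h2 := hLq (x (k + 1) - x k)
    have h3 : 1 / lamp ≤ (lam k)⁻¹ := by
      rw [← one_div]; exact one_div_le_one_div_of_le (hl k) (hlam k).2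
    have h4 := mul_le_mul_of_nonneg_right h3 (sq_nonneg ‖x (k + 1) - x k‖)
    have e : inner ℝ (T.adjoint (T (x k) - d)) (x (k + 1) - x k)
      = (inner ℝ (g (x k)) (x (k + 1) - x k) : ℝ) := rfl
    rw [e, ha]
    linarith
  have hf0 : ∀ z, 0 ≤ f z := by
    intro z; rw [hf]; positivity
  have hanti : Antitone fun k => f (x k) := by
    refine antitone_nat_of_succ_le fun k => ?_
    have := hdesc k
    have : 0 ≤ a * ‖x (k + 1) - x k‖ ^ 2 := by positivity
    linarith
  have hbd : ∀ k, ‖x (k + 1)‖ ≤ f (x 0) / μ := by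
    intro k
    have h1 : f (x (k + 1)) ≤ f (x 0) := hanti (Nat.zero_le _)
    rw [le_div_iff₀ hμ]
    have h2 : ‖x (k + 1)‖ ≤ ∑ i, |x (k + 1) i| := by
      rw [EuclideanSpace.norm_eq]
      apply Real.sqrt_le_iff.2 ⟨by positivity, ?_⟩
      simp only [Real.norm_eq_abs]
      exact Finset.sum_sq_le_sq_sum_of_nonneg fun i _ => abs_nonneg _
    have h3 := hf (x (k + 1))
    have h4 : 0 ≤ 1 / 2 * ‖T (x (k + 1)) - d‖ ^ 2 := by positivity
    nlinarith
  have hw0 : Tendsto w atTop (nhds 0) := by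
    have hconv : Tendsto (fun k => f (x k)) atTop (nhds (⨅ k, f (x k))) :=
      tendsto_atTop_ciInf hanti ⟨0, by rintro _ ⟨k, rfl⟩; exact hf0 _⟩
    have h1 : Tendsto (fun k => Real.sqrt ((f (x k) - f (x (k + 1))) / a)) atTop (nhds 0) := by
      have := ((hconv.sub (hconv.comp (tendsto_add_atTop_nat 1))).div_const a).sqrt
      simpa using this
    refine squeeze_zero_norm (fun k => ?_) (by simpa using h1.const_mul b)
    refine (hwb k).trans ?_
    gcongr
    apply Real.le_sqrt_of_sq_le
    rw [le_div_iff₀ ha0, mul_comm]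
    exact hdesc k
  obtain ⟨xs, hmin, ⟨φ, hφ, hφx⟩, C, hC, hCk⟩ := aux_core T d μ f hf (fun k => x (k + 1)) u w hu
    (fun k => rfl) hw0 _ hbd
  obtain ⟨γ, hγ, h1, h2, h3⟩ := aux_final x xs (fun k => f (x k) - f xs) a b (C * b ^ 2) ha0 hb0
    (by positivity) (fun k => sub_nonneg.2 (hmin _))
    (fun k => by have := hdesc k; linarith)
    (fun k => by
      refine (hCk k).trans ?_
      rw [mul_assoc, ← mul_pow]
      have := hwb k
      gcongr)
    ⟨fun k => φ k + 1, tendsto_add_atTop_nat 1 |>.comp hφ, hφx⟩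
  exact ⟨γ, hγ, xs, hmin, h1, h2, h3⟩
end
end

section
/- Error bounds do not imply the KL inequality (Theorem 6.2): there exists a twice continuously differentiable convex function f : ℝ² → ℝ with min f = 0 and argmin f equal to the closed unit disk S = {x ∈ ℝ² : ‖x‖ ≤ 1}, such that: (a) there exists a convex, continuously differentiable function Ψ : [0,∞) → [0,∞) with Ψ(0) = 0 and Ψ(s) > 0 for s > 0 satisfying f(x) ≥ Ψ(dist(x, S)) for all x ∈ ℝ² (a smooth error bound); and (b) f fails every KL inequality: for every r₀ > 0 and every φ ∈ 𝒦(0,r₀) there exists x ∈ ℝ² with 0 < f(x) < r₀ and φ′(f(x))·‖∇f(x)‖ < 1. -/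
open Metric Set Filter

noncomputable section

abbrev EE := EuclideanSpace ℝ (Fin 2)

/-- cubic positive part -/
def hh (r : ℝ) : ℝ := (max r 0) ^ 3

lemma hh_nonneg (r : ℝ) : 0 ≤ hh r := by unfold hh; positivity
lemma hh_pos {r : ℝ} (h : 0 < r) : 0 < hh r := by unfold hh; rw [max_eq_left h.le]; positivity
lemma hh_zero {r : ℝ} (h : r ≤ 0) : hh r = 0 := by unfold hh; rw [max_eq_right h]; norm_num
lemma hh_mono {r s : ℝ} (h : r ≤ s) : hh r ≤ hh s := by
  unfold hh; gcongr
lemma hh_of_nonneg {r : ℝ} (h : 0 ≤ r) : hh r = r ^ 3 := by unfold hh; rw [max_eq_left h]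

lemma hh_convex : ConvexOn ℝ univ hh := by
  have h1 : ConvexOn ℝ univ (fun r : ℝ => max r 0) :=
    (convexOn_id convex_univ).sup (convexOn_const 0 convex_univ)
  exact h1.pow (fun x _ => le_max_right _ _) 3

lemma hasDerivAt_maxpow (n : ℕ) (r : ℝ) :
    HasDerivAt (fun r : ℝ => (max r 0) ^ (n + 2)) ((n + 2) * (max r 0) ^ (n + 1)) r := by
  rcases lt_trichotomy r 0 with h | h | h
  · rw [max_eq_right h.le]
    have : (fun r : ℝ => (max r 0) ^ (n + 2)) =ᶠ[nhds r] fun _ => 0 := by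
      filter_upwards [gt_mem_nhds h] with y hy
      rw [max_eq_right (le_of_lt hy)]; simp
    simpa using (hasDerivAt_const r (0 : ℝ)).congr_of_eventuallyEq this
  · subst h
    simp only [max_self, ne_eq, Nat.add_eq_zero_iff, one_ne_zero, and_false, not_false_eq_true, zero_pow, mul_zero]
    rw [hasDerivAt_iff_isLittleO_nhds_zero]
    simp only [zero_add, max_self, smul_zero, sub_zero]
    have h1 : (fun r : ℝ => r ^ (n + 2)) =o[nhds 0] (fun r : ℝ => r) := by
      simpa using Asymptotics.isLittleO_pow_id (𝕜 := ℝ) (n := n + 2) (by omega)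
    refine Asymptotics.IsBigO.trans_isLittleO ?_ h1
    refine Asymptotics.IsBigO.of_bound 1 (Eventually.of_forall fun y => ?_)
    simp only [ne_eq, Nat.add_eq_zero_iff, OfNat.ofNat_ne_zero, and_false, not_false_eq_true, zero_pow, sub_zero, norm_pow, one_mul]
    gcongr
    rw [Real.norm_eq_abs, Real.norm_eq_abs]
    rcases le_total y 0 with h | h
    · rw [max_eq_right h]; simp
    · rw [max_eq_left h]
  · rw [max_eq_left h.le]
    have : (fun r : ℝ => (max r 0) ^ (n + 2)) =ᶠ[nhds r] fun r => r ^ (n + 2) := by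
      filter_upwards [lt_mem_nhds h] with y hy
      rw [max_eq_left (le_of_lt hy)]
    have h2 := (hasDerivAt_pow (n + 2) r).congr_of_eventuallyEq this
    have e : ((n + 2 : ℕ) : ℝ) * r ^ (n + 2 - 1) = (n + 2) * r ^ (n + 1) := by
      push_cast; rfl
    rw [e] at h2
    exact h2

lemma hh_contDiff : ContDiff ℝ 2 hh := by
  have d1 : deriv hh = fun r => 3 * (max r 0) ^ 2 := by
    ext r
    rw [show hh = fun r => (max r 0) ^ (1 + 2) from rfl, (hasDerivAt_maxpow 1 r).deriv]; norm_num
  have e : (2 : WithTop ℕ∞) = 1 + 1 := by norm_num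
  rw [e, contDiff_succ_iff_deriv]
  refine ⟨fun r => (hasDerivAt_maxpow 1 r).differentiableAt, by simp, ?_⟩
  rw [d1]
  apply contDiff_const.mul
  rw [contDiff_one_iff_deriv]
  refine ⟨fun r => (hasDerivAt_maxpow 0 r).differentiableAt, ?_⟩
  have d2 : deriv (fun r : ℝ => (max r 0) ^ 2) = fun r => 2 * max r 0 := by
    ext r
    rw [(hasDerivAt_maxpow 0 r).deriv]; norm_num
  rw [d2]; fun_prop

def th (n : ℕ) : ℝ := Real.sqrt (n + 1)
def tt (n : ℕ) : ℝ := 1 + 1 / th n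
def uu (n : ℕ) : EE := !₂[Real.cos (th n), Real.sin (th n)]
def et (n : ℕ) : ℝ := 1 / (60 * (n + 1))
def cc : ℕ → ℝ
  | 0 => 1
  | n + 1 => cc n * (et n) ^ 3 / 54

lemma th_pos (n : ℕ) : 0 < th n := by unfold th; positivity
lemma th_sq (n : ℕ) : th n ^ 2 = n + 1 := by unfold th; rw [Real.sq_sqrt]; positivity
lemma th_one (n : ℕ) : 1 ≤ th n := by unfold th; rw [Real.one_le_sqrt]; linarith [n.cast_nonneg (α := ℝ)]
lemma tt_one (n : ℕ) : 1 < tt n := by unfold tt; have := th_pos n; simp; assumption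
lemma tt_two (n : ℕ) : tt n ≤ 2 := by
  unfold tt; have := th_one n
  have : 1 / th n ≤ 1 := by rw [div_le_one (th_pos n)]; exact this
  linarith
lemma et_pos (n : ℕ) : 0 < et n := by unfold et; positivity
lemma et_le (n : ℕ) : et n ≤ 1 / 60 := by
  unfold et; apply one_div_le_one_div_of_le <;> linarith [n.cast_nonneg (α := ℝ)]
lemma et3_le (n : ℕ) : et n ^ 3 ≤ 1 / 60 := by
  have := et_le n; have h := et_pos n
  calc et n ^ 3 ≤ (1/60) ^ 3 := by gcongr
    _ ≤ _ := by norm_num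
lemma cc_pos (n : ℕ) : 0 < cc n := by
  induction n with
  | zero => norm_num [cc]
  | succ n ih => rw [cc]; have := et_pos n; positivity
lemma cc_half (n : ℕ) : cc (n + 1) ≤ cc n / 2 := by
  rw [cc]; have := et3_le n; have := cc_pos n; nlinarith
lemma cc_geo (n i : ℕ) : cc (i + n) ≤ cc n * (1 / 2) ^ i := by
  induction i with
  | zero => simp
  | succ i ih =>
    have := cc_half (i + n)
    rw [show i + 1 + n = i + n + 1 by ring, pow_succ]; linarith
lemma cc_tail_summable (n : ℕ) : Summable (fun i => cc (i + n)) :=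
  Summable.of_nonneg_of_le (fun _ => (cc_pos _).le) (fun i => cc_geo n i)
    (summable_geometric_two.mul_left _)
lemma cc_summable : Summable cc := cc_tail_summable 0
lemma cc_tail (n : ℕ) : ∑' i, cc (i + n) ≤ 2 * cc n := by
  calc _ ≤ ∑' i : ℕ, cc n * (1 / 2) ^ i :=
        (cc_tail_summable n).tsum_le_tsum (fun i => cc_geo n i) (summable_geometric_two.mul_left _)
    _ = _ := by rw [tsum_mul_left, tsum_geometric_two]; ring

lemma inner_uu (n : ℕ) (x : EE) : inner ℝ (uu n) x = Real.cos (th n) * x 0 + Real.sin (th n) * x 1 := by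
  simp [uu, PiLp.inner_apply, Fin.sum_univ_two]; ring
lemma norm_uu (n : ℕ) : ‖uu n‖ = 1 := by
  rw [EuclideanSpace.norm_eq]; simp [uu, Fin.sum_univ_two]
lemma inner_uu_uu (n m : ℕ) : inner ℝ (uu n) (uu m) = Real.cos (th m - th n) := by
  rw [inner_uu, Real.cos_sub]; simp [uu]; ring
lemma inner_uu_le (n : ℕ) (x : EE) : inner ℝ (uu n) x ≤ ‖x‖ := by
  have := real_inner_le_norm (uu n) x; rwa [norm_uu, one_mul] at this

def FF (n : ℕ) (x : EE) : ℝ := cc n * hh (inner ℝ (uu n) x - tt n)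
def ff (x : EE) : ℝ := ∑' n, FF n x

lemma FF_nonneg (n : ℕ) (x : EE) : 0 ≤ FF n x := mul_nonneg (cc_pos n).le (hh_nonneg _)
lemma FF_le (n : ℕ) (x : EE) : FF n x ≤ cc n * ‖x‖ ^ 3 := by
  unfold FF
  have := cc_pos n
  rw [← hh_of_nonneg (norm_nonneg x)]
  gcongr
  exact hh_mono (by linarith [inner_uu_le n x, tt_one n])
lemma FF_summable (x : EE) : Summable (fun n => FF n x) :=
  Summable.of_nonneg_of_le (fun n => FF_nonneg n x) (fun n => FF_le n x) (cc_summable.mul_right _)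
lemma FF_le_ff (n : ℕ) (x : EE) : FF n x ≤ ff x :=
  (FF_summable x).le_tsum n (fun j _ => FF_nonneg j x)
lemma ff_nonneg (x : EE) : 0 ≤ ff x := tsum_nonneg fun n => FF_nonneg n x

lemma FF_convex (n : ℕ) : ConvexOn ℝ univ (FF n) := by
  refine ⟨convex_univ, fun x _ y _ a b ha hb hab => ?_⟩
  have h := hh_convex.2 (mem_univ (inner ℝ (uu n) x - tt n)) (mem_univ (inner ℝ (uu n) y - tt n)) ha hb hab
  unfold FF
  have e : inner ℝ (uu n) (a • x + b • y) - tt n = a • (inner ℝ (uu n) x - tt n) + b • (inner ℝ (uu n) y - tt n) := by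
    rw [inner_add_right, inner_smul_right, inner_smul_right]
    simp only [smul_eq_mul]
    linear_combination tt n * hab
  rw [e]
  have := mul_le_mul_of_nonneg_left h (cc_pos n).le
  simp only [smul_eq_mul] at *
  linarith

lemma ff_convex : ConvexOn ℝ univ ff := by
  refine ⟨convex_univ, fun x _ y _ a b ha hb hab => ?_⟩
  have s : Summable fun n => a • FF n x + b • FF n y :=
    ((FF_summable x).mul_left a).add ((FF_summable y).mul_left b)
  have h := (FF_summable (a • x + b • y)).tsum_le_tsum
    (fun n => (FF_convex n).2 (mem_univ x) (mem_univ y) ha hb hab) s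
  simp only [smul_eq_mul] at *
  rw [((FF_summable x).mul_left a).tsum_add ((FF_summable y).mul_left b), tsum_mul_left, tsum_mul_left] at h
  exact h

lemma ff_zero {x : EE} (hx : ‖x‖ ≤ 1) : ff x = 0 := by
  unfold ff
  have : ∀ n, FF n x = 0 := fun n => by
    unfold FF; rw [hh_zero, mul_zero]; linarith [inner_uu_le n x, tt_one n]
  simp [this]

lemma ff_pos {x : EE} (hx : 1 < ‖x‖) : 0 < ff x := by
  suffices ∃ n, tt n < inner ℝ (uu n) x by
    obtain ⟨n, hn⟩ := this
    exact lt_of_lt_of_le (mul_pos (cc_pos n) (hh_pos (by linarith))) (FF_le_ff n x)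
  set z : ℂ := ⟨x 0, x 1⟩ with hz
  set R := ‖x‖ with hR
  have hzR : ‖z‖ = R := by
    rw [hR, EuclideanSpace.norm_eq, Complex.norm_eq_sqrt_sq_add_sq]; simp [Fin.sum_univ_two, hz]
  have hc : x 0 = R * Real.cos z.arg := by rw [← hzR, Complex.norm_mul_cos_arg]
  have hs : x 1 = R * Real.sin z.arg := by rw [← hzR, Complex.norm_mul_sin_arg]
  obtain ⟨j, hj⟩ := exists_nat_gt (max 1 ((R + 1) / (R - 1)) - z.arg)
  set τ := z.arg + j * (2 * Real.pi) with hτ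
  have hjτ : max 1 ((R + 1) / (R - 1)) < τ := by
    have : (j : ℝ) ≤ j * (2 * Real.pi) := by
      have := Real.pi_gt_three
      have := j.cast_nonneg (α := ℝ)
      nlinarith
    linarith
  have h1 : 1 < τ := (le_max_left _ _).trans_lt hjτ
  have h2 : R + 1 < τ * (R - 1) := by
    have := (le_max_right _ _).trans_lt hjτ
    rwa [div_lt_iff₀ (by linarith)] at this
  refine ⟨⌊τ ^ 2⌋₊, ?_⟩
  set n := ⌊τ ^ 2⌋₊ with hn
  have hn1 : τ ^ 2 < n + 1 := Nat.lt_floor_add_one _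
  have hn2 : (n : ℝ) ≤ τ ^ 2 := Nat.floor_le (by positivity)
  rw [← th_sq] at hn1
  have hn3 : th n ^ 2 ≤ τ ^ 2 + 1 := by rw [th_sq]; linarith
  have hp := th_pos n
  have ha : τ < th n := lt_of_pow_lt_pow_left₀ 2 hp.le hn1
  have hb : (th n - τ) * τ ≤ 1 / 2 := by nlinarith
  have e : inner ℝ (uu n) x = R * Real.cos (th n - τ) := by
    rw [inner_uu, hc, hs, hτ, ← sub_sub, Real.cos_sub_nat_mul_two_pi, Real.cos_sub]; ring
  rw [e]
  have hcos := Real.one_sub_sq_div_two_le_cos (x := th n - τ)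
  have hd : (th n - τ) ^ 2 * τ ≤ 1 := by
    have : th n - τ ≤ 1 := by nlinarith
    nlinarith
  have ht : tt n * τ ≤ τ + 1 := by
    unfold tt
    have : 1 / th n * τ ≤ 1 := by rw [div_mul_eq_mul_div, one_mul, div_le_one hp]; exact ha.le
    linarith
  have : tt n * τ < R * Real.cos (th n - τ) * τ := by
    have : R * (1 - (th n - τ) ^ 2 / 2) * τ ≤ R * Real.cos (th n - τ) * τ := by gcongr
    nlinarith
  exact lt_of_mul_lt_mul_right this (by linarith)

/-- the geometric separation fact -/
lemma sep {i n : ℕ} (h : i < n) : tt n * Real.cos (th n - th i) + 3 * et n ≤ tt i := by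
  have hn := th_sq n
  have hi := th_sq i
  have pn := th_pos n
  have pi := th_pos i
  have hin : (i : ℝ) + 1 ≤ n := by exact_mod_cast h
  set A := th n with hA
  set B := th i with hB
  have hAB : B < A := lt_of_pow_lt_pow_left₀ 2 pn.le (by rw [hn, hi]; linarith)
  have hprod : 1 ≤ (A - B) * (2 * A) := by nlinarith
  have het : et n = 1 / (60 * A ^ 2) := by unfold et; rw [hn]
  have hdiff : (A - B) / A ^ 2 ≤ tt i - tt n := by
    unfold tt
    rw [← hA, ← hB]
    have : 1 + 1 / B - (1 + 1 / A) = (A - B) / (B * A) := by field_simp; ring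
    rw [this]
    apply div_le_div_of_nonneg_left (by linarith) (by positivity)
    nlinarith
  have h1 := tt_one n
  have h2 := Real.cos_le_one (A - B)
  have hA2 : 0 < A ^ 2 := by positivity
  have h3e : 3 * et n = (1 / 20) / A ^ 2 := by rw [het]; field_simp; norm_num
  rw [h3e]
  rcases le_total 1 (A - B) with h | h
  · have : (1 / 20) / A ^ 2 ≤ (A - B) / A ^ 2 := by gcongr; linarith
    nlinarith
  · have hc := Real.cos_le_one_sub_mul_cos_sq (x := A - B) (by
      rw [abs_of_nonneg (by linarith)]; linarith [Real.pi_gt_three])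
    have hpi : 1 / 5 ≤ 2 / Real.pi ^ 2 := by
      rw [div_le_div_iff₀ (by norm_num) (by positivity)]
      have := Real.pi_lt_d2
      have := Real.pi_pos
      nlinarith
    have hx : (1 / 20) / A ^ 2 ≤ 1 / 5 * (A - B) ^ 2 := by
      rw [div_le_iff₀ hA2]
      nlinarith
    have hx2 : (1 / 20) / A ^ 2 ≤ 1 - Real.cos (A - B) := by
      have := mul_le_mul_of_nonneg_right hpi (sq_nonneg (A - B))
      linarith
    have : 0 ≤ (A - B) / A ^ 2 := div_nonneg (by linarith) hA2.le
    have hnn : 0 ≤ (1 / 20) / A ^ 2 := by positivity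
    nlinarith

def xx (n : ℕ) : EE := (tt n + 2 * et n) • uu n

lemma norm_xx (n : ℕ) : ‖xx n‖ = tt n + 2 * et n := by
  have := tt_one n; have := et_pos n
  rw [xx, norm_smul, norm_uu, mul_one, Real.norm_eq_abs, abs_of_pos (by linarith)]

lemma ff_xx_lower (n : ℕ) : 8 * (cc n * et n ^ 3) ≤ ff (xx n) := by
  refine le_trans (le_of_eq ?_) (FF_le_ff n (xx n))
  have : inner ℝ (uu n) (xx n) - tt n = 2 * et n := by
    rw [xx, inner_smul_right, inner_uu_uu]; simp
  rw [FF, this, hh_of_nonneg (by linarith [et_pos n])]; ring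

lemma ff_ball_upper (n : ℕ) (y : EE) (hy : ‖y - xx n‖ ≤ et n) : ff y ≤ 28 * (cc n * et n ^ 3) := by
  have he := et_pos n
  have hin : ∀ i, inner ℝ (uu i) y ≤ (tt n + 2 * et n) * Real.cos (th n - th i) + et n := by
    intro i
    have : inner ℝ (uu i) y = inner ℝ (uu i) (xx n) + inner ℝ (uu i) (y - xx n) := by
      rw [← inner_add_right]; congr 1; abel
    rw [this, xx, inner_smul_right, inner_uu_uu, ← xx]
    linarith [inner_uu_le i (y - xx n)]
  have hny : ‖y‖ ≤ 3 := by
    have : ‖y‖ ≤ ‖y - xx n‖ + ‖xx n‖ := by simpa using norm_add_le (y - xx n) (xx n)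
    rw [norm_xx] at this
    linarith [tt_two n, et_le n]
  have h0 : ∀ i ∈ Finset.range n, FF i y = 0 := by
    intro i hi
    rw [Finset.mem_range] at hi
    rw [FF, hh_zero, mul_zero]
    have := hin i
    have := sep hi
    have := Real.cos_le_one (th n - th i)
    nlinarith
  have hnn : FF n y ≤ cc n * (27 * et n ^ 3) := by
    unfold FF
    apply mul_le_mul_of_nonneg_left _ (cc_pos n).le
    have := hin n
    rw [sub_self, Real.cos_zero] at this
    have h3 : inner ℝ (uu n) y - tt n ≤ 3 * et n := by linarith
    have := hh_mono h3
    rw [hh_of_nonneg (r := 3 * et n) (by linarith)] at this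
    linarith
  have htail : ∑' i, FF (i + (n + 1)) y ≤ cc n * et n ^ 3 := by
    calc _ ≤ ∑' i, cc (i + (n + 1)) * 27 := by
          refine ((summable_nat_add_iff (n+1)).2 (FF_summable y)).tsum_le_tsum (fun i => ?_)
            ((cc_tail_summable (n + 1)).mul_right _)
          refine (FF_le _ _).trans ?_
          apply mul_le_mul_of_nonneg_left _ (cc_pos _).le
          calc ‖y‖ ^ 3 ≤ 3 ^ 3 := by gcongr
            _ = 27 := by norm_num
      _ ≤ 2 * cc (n + 1) * 27 := by rw [tsum_mul_right]; gcongr; exact cc_tail _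
      _ = _ := by rw [cc]; ring
  unfold ff
  rw [← (FF_summable y).sum_add_tsum_nat_add (n + 1), Finset.sum_range_succ, Finset.sum_eq_zero h0]
  linarith

lemma ff_xx_half (n : ℕ) : ff (xx (n + 1)) ≤ ff (xx n) / 2 := by
  have h1 := ff_ball_upper (n + 1) (xx (n + 1)) (by simp [(et_pos _).le])
  have h2 := ff_xx_lower n
  have h3 := et3_le (n + 1)
  have h4 : cc (n + 1) = cc n * et n ^ 3 / 54 := rfl
  have h5 := cc_pos (n + 1)
  nlinarith

lemma ff_contDiff : ContDiff ℝ 2 ff := by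
  rw [contDiff_iff_contDiffAt]
  intro x0
  set R : ℝ := ‖x0‖ + 4 with hR
  have hRp : 0 < R := by positivity
  let b : ContDiffBump (0 : ℝ) := ⟨R, R + 1, hRp, by linarith⟩
  let g : ℝ → ℝ := fun r => b r * hh r
  have hg : ContDiff ℝ 2 g := b.contDiff.mul hh_contDiff
  have hgs : HasCompactSupport g := b.hasCompactSupport.mul_right
  have hbd : ∀ k : ℕ, ∃ C : ℝ, (k : WithTop ℕ∞) ≤ 2 → ∀ r, ‖iteratedFDeriv ℝ k g r‖ ≤ C := by
    intro k
    by_cases hk : (k : WithTop ℕ∞) ≤ 2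
    · obtain ⟨C, hC⟩ := (hgs.iteratedFDeriv k).exists_bound_of_continuous (hg.continuous_iteratedFDeriv hk)
      exact ⟨C, fun _ => hC⟩
    · exact ⟨0, fun h => absurd h hk⟩
  choose C hC using hbd
  have key : ContDiff ℝ ((2 : ℕ∞) : WithTop ℕ∞) (fun x : EE => ∑' n, cc n * g (inner ℝ (uu n) x - tt n)) := by
    have hsm : ∀ n, ContDiff ℝ ((2 : ℕ∞) : WithTop ℕ∞) (fun y => g (y - tt n)) := fun n =>
      hg.comp (contDiff_id.sub contDiff_const)
    refine contDiff_tsum (v := fun k n => cc n * C k) (fun n => ?_) (fun k _ => cc_summable.mul_right _) ?_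
    · exact contDiff_const.mul ((hsm n).comp (innerSL ℝ (uu n)).contDiff)
    · intro k n x hk
      have hk' : (k : WithTop ℕ∞) ≤ 2 := by exact_mod_cast hk
      have e : (fun x : EE => cc n * g (inner ℝ (uu n) x - tt n))
          = cc n • ((fun y => g (y - tt n)) ∘ (innerSL ℝ (uu n))) := by
        ext x; simp
      have hk2 : (k : WithTop ℕ∞) ≤ ((2 : ℕ∞) : WithTop ℕ∞) := by exact_mod_cast hk
      have hcd : ContDiff ℝ ((2 : ℕ∞) : WithTop ℕ∞) ((fun y => g (y - tt n)) ∘ (innerSL ℝ (uu n))) :=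
        (hsm n).comp (innerSL ℝ (uu n)).contDiff
      rw [e, iteratedFDeriv_const_smul_apply ((hcd.of_le hk2).contDiffAt), norm_smul,
        Real.norm_eq_abs, abs_of_pos (cc_pos n),
        ContinuousLinearMap.iteratedFDeriv_comp_right _ (hsm n) x hk2]
      gcongr
      · exact (cc_pos n).le
      refine (ContinuousMultilinearMap.norm_compContinuousLinearMap_le _ _).trans ?_
      simp only [innerSL_apply_norm, norm_uu, Finset.prod_const_one, mul_one]
      rw [iteratedFDeriv_comp_sub]
      exact hC k hk' _
  refine key.contDiffAt.congr_of_eventuallyEq ?_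
  have : ball x0 1 ∈ nhds x0 := ball_mem_nhds _ one_pos
  filter_upwards [this] with y hy
  unfold ff FF
  congr 1
  ext n
  congr 1
  have hb : b (inner ℝ (uu n) y - tt n) = 1 := by
    apply b.one_of_mem_closedBall
    simp only [mem_closedBall, dist_zero_right, Real.norm_eq_abs]
    have h1 := abs_real_inner_le_norm (uu n) y
    rw [norm_uu, one_mul] at h1
    have h2 : ‖y‖ ≤ ‖x0‖ + 1 := by
      rw [mem_ball, dist_eq_norm] at hy
      have := norm_add_le (y - x0) x0
      simp at this; linarith
    have h3 := tt_two n
    have h4 := tt_one n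
    show _ ≤ R
    rw [abs_le] at h1 ⊢
    constructor <;> linarith [h1.1, h1.2]
  simp [g, hb]

lemma grad_bound (n : ℕ) : et n * ‖gradient ff (xx n)‖ ≤ 4 * ff (xx n) := by
  set x := xx n with hx
  set G := gradient ff x with hG
  rcases eq_or_ne G 0 with h0 | h0
  · rw [h0]; simp [ff_nonneg]
  have hGp : 0 < ‖G‖ := norm_pos_iff.2 h0
  have he := et_pos n
  set v : EE := (et n / ‖G‖) • G with hv
  have hgrad : HasGradientAt ff G x := (ff_contDiff.differentiable (by norm_num) x).hasGradientAt
  let q : ℝ → ℝ := fun s => ff (x + s • v)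
  have hq : ConvexOn ℝ univ q := by
    refine ⟨convex_univ, fun s _ t _ a b ha hb hab => ?_⟩
    have h := ff_convex.2 (mem_univ (x + s • v)) (mem_univ (x + t • v)) ha hb hab
    have e : a • (x + s • v) + b • (x + t • v) = x + (a • s + b • t) • v := by
      have : x = (a + b) • x := by rw [hab, one_smul]
      conv_rhs => rw [this]
      simp only [smul_eq_mul]
      module
    rw [e] at h
    exact h
  have hd : HasDerivAt q (inner ℝ G v) 0 := by
    have h1 : HasDerivAt (fun s : ℝ => x + s • v) v 0 := by
      simpa using ((hasDerivAt_id (0 : ℝ)).smul_const v).const_add x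
    have h2 : HasFDerivAt ff ((InnerProductSpace.toDual ℝ EE) G) (x + (0 : ℝ) • v) := by
      simpa using hgrad.hasFDerivAt
    have := h2.comp_hasDerivAt (0 : ℝ) h1
    rw [InnerProductSpace.toDual_apply_apply] at this
    exact this
  have hs := hq.le_slope_of_hasDerivAt (mem_univ 0) (mem_univ 1) one_pos hd
  rw [slope_def_field] at hs
  have hi : inner ℝ G v = et n * ‖G‖ := by
    rw [hv, inner_smul_right, real_inner_self_eq_norm_sq]; field_simp
  simp only [q, zero_smul, add_zero, one_smul, sub_zero, div_one] at hs
  have hup := ff_ball_upper n (x + v) (by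
    rw [← hx]; simp only [add_sub_cancel_left]
    rw [hv, norm_smul, Real.norm_eq_abs, abs_of_pos (by positivity)]
    field_simp; rfl)
  have := ff_xx_lower n
  rw [← hx] at this
  have := mul_pos (cc_pos n) (pow_pos he 3)
  rw [hi] at hs
  linarith

lemma ff_xx_pos (n : ℕ) : 0 < ff (xx n) :=
  lt_of_lt_of_le (by have := mul_pos (cc_pos n) (pow_pos (et_pos n) 3); linarith) (ff_xx_lower n)

lemma ff_xx_anti : ∀ n, ff (xx n) ≤ ff (xx 0) * (1 / 2) ^ n := by
  intro n
  induction n with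
  | zero => simp
  | succ n ih => have := ff_xx_half n; rw [pow_succ]; linarith

lemma kl_fail (r0 : ℝ) (hr : 0 < r0) (φ φ' : ℝ → ℝ)
    (hd : ∀ s ∈ Ioo (0 : ℝ) r0, HasDerivAt φ (φ' s) s)
    (hc : ConcaveOn ℝ (Ico 0 r0) φ) (h0 : φ 0 = 0)
    (hp : ∀ s ∈ Ioo (0 : ℝ) r0, 0 < φ' s) :
    ∃ x : EE, 0 < ff x ∧ ff x < r0 ∧ φ' (ff x) * ‖gradient ff x‖ < 1 := by
  by_contra! hcon
  have ht : Tendsto (fun n : ℕ => ff (xx 0) * (1 / 2 : ℝ) ^ n) atTop (nhds 0) := by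
    simpa using (tendsto_pow_atTop_nhds_zero_of_lt_one (by norm_num : (0:ℝ) ≤ 1 / 2) (by norm_num)).const_mul (ff (xx 0))
  obtain ⟨K, hK⟩ := eventually_atTop.1 (ht.eventually (gt_mem_nhds hr))
  have hlt : ∀ n, K ≤ n → ff (xx n) < r0 := fun n hn => (ff_xx_anti n).trans_lt (hK n hn)
  have step : ∀ n, K ≤ n → et n / 8 ≤ φ (ff (xx n)) - φ (ff (xx (n + 1))) := by
    intro n hn
    have a1 := ff_xx_pos n
    have a2 := ff_xx_pos (n + 1)
    have a3 := ff_xx_half n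
    have a4 := hlt n hn
    have h1 := hcon (xx n) a1 a4
    have h2 := grad_bound n
    have h3 := hp _ ⟨a1, a4⟩
    have hsl := hc.le_slope_of_hasDerivAt (x := ff (xx (n + 1))) (y := ff (xx n)) ⟨a2.le, by linarith⟩ ⟨a1.le, a4⟩
      (by linarith) (hd _ ⟨a1, a4⟩)
    rw [slope_def_field, le_div_iff₀ (by linarith)] at hsl
    have he := et_pos n
    have b1 : et n ≤ φ' (ff (xx n)) * (4 * ff (xx n)) := by
      calc et n ≤ et n * (φ' (ff (xx n)) * ‖gradient ff (xx n)‖) := by nlinarith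
        _ = φ' (ff (xx n)) * (et n * ‖gradient ff (xx n)‖) := by ring
        _ ≤ _ := by gcongr
    have b2 : φ' (ff (xx n)) * (ff (xx n) / 2) ≤ φ' (ff (xx n)) * (ff (xx n) - ff (xx (n + 1))) := by
      gcongr; linarith
    linarith
  have hnn : ∀ n, K ≤ n → 0 ≤ φ (ff (xx n)) := by
    intro n hn
    have a1 := ff_xx_pos n
    have a4 := hlt n hn
    have hsl := hc.le_slope_of_hasDerivAt (x := 0) (y := ff (xx n)) ⟨le_rfl, hr⟩ ⟨a1.le, a4⟩ a1 (hd _ ⟨a1, a4⟩)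
    rw [slope_def_field, le_div_iff₀ (by linarith), h0] at hsl
    have := mul_pos (hp _ ⟨a1, a4⟩) a1
    simp at hsl; linarith
  have hsum : ∀ m, ∑ i ∈ Finset.range m, et (i + K) / 8 ≤ φ (ff (xx K)) := by
    intro m
    have : ∑ i ∈ Finset.range m, et (i + K) / 8 ≤ φ (ff (xx K)) - φ (ff (xx (m + K))) := by
      induction m with
      | zero => simp
      | succ m ih =>
        rw [Finset.sum_range_succ]
        have := step (m + K) (by omega)
        rw [show m + 1 + K = m + K + 1 by ring]
        linarith
    linarith [hnn (m + K) (by omega)]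
  have hS : Summable (fun i => et (i + K) / 8) :=
    summable_of_sum_range_le (fun i => by have := et_pos (i + K); positivity) hsum
  have hS2 : Summable et := by
    have := (summable_nat_add_iff (f := fun i => et i / 8) K).1 hS
    simpa using this.mul_right 8
  have hS3 : Summable (fun n : ℕ => 1 / ((n + 1 : ℕ) : ℝ)) := by
    refine (hS2.mul_left 60).congr fun n => ?_
    unfold et; push_cast; field_simp
  exact Real.not_summable_one_div_natCast ((summable_nat_add_iff (f := fun n : ℕ => 1 / (n : ℝ)) 1).1 hS3)

/-- radial minimum -/
def mm (r : ℝ) : ℝ := sInf ((fun x : EE => ff ((1 + max r 0) • x)) '' sphere 0 1)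

lemma sphere_ne : (sphere (0 : EE) 1).Nonempty := ⟨uu 0, by simp [norm_uu]⟩

lemma mm_cont : Continuous mm := by
  refine IsCompact.continuous_sInf (f := fun (r : ℝ) (x : EE) => ff ((1 + max r 0) • x)) (isCompact_sphere 0 1) ?_
  have := ff_contDiff.continuous
  have h2 : Continuous fun p : ℝ × EE => ff ((1 + max p.1 0) • p.2) := by fun_prop
  exact h2

lemma mm_le (r : ℝ) (x : EE) (hx : ‖x‖ = 1) : mm r ≤ ff ((1 + max r 0) • x) := by
  refine csInf_le ⟨0, ?_⟩ ⟨x, by simpa using hx, rfl⟩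
  rintro _ ⟨y, _, rfl⟩
  exact ff_nonneg _

lemma mm_attain (r : ℝ) : ∃ x : EE, ‖x‖ = 1 ∧ mm r = ff ((1 + max r 0) • x) := by
  have hc : Continuous fun x : EE => ff ((1 + max r 0) • x) := by
    have := ff_contDiff.continuous
    fun_prop
  obtain ⟨x, hx, h⟩ := (isCompact_sphere (0 : EE) 1).exists_sInf_image_eq sphere_ne hc.continuousOn
  exact ⟨x, by simpa using hx, h⟩

lemma mm_pos {r : ℝ} (h : 0 < r) : 0 < mm r := by
  obtain ⟨x, hx, e⟩ := mm_attain r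
  rw [e]; apply ff_pos
  rw [norm_smul, hx, max_eq_left h.le, mul_one, Real.norm_eq_abs, abs_of_pos (by linarith)]; linarith

lemma mm_nonneg (r : ℝ) : 0 ≤ mm r := by
  obtain ⟨x, hx, e⟩ := mm_attain r
  rw [e]; exact ff_nonneg _

lemma mm_scale {r s : ℝ} (hr : 0 ≤ r) (hs : 0 < s) (h : r ≤ s) : mm r ≤ r / s * mm s := by
  obtain ⟨x, hx, e⟩ := mm_attain s
  have h1 := mm_le r x hx
  rw [max_eq_left hr] at h1
  rw [max_eq_left hs.le] at e
  have hl : r / s ≤ 1 := (div_le_one hs).2 h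
  have h0 : 0 ≤ r / s := by positivity
  have hcv := ff_convex.2 (mem_univ x) (mem_univ ((1 + s) • x)) (sub_nonneg.2 hl) h0 (by ring)
  have e2 : (1 - r / s) • x + (r / s) • (1 + s) • x = (1 + r) • x := by
    rw [smul_smul, ← add_smul]; congr 1; field_simp; ring
  rw [e2, ff_zero hx.le, ← e] at hcv
  simp only [smul_eq_mul, mul_zero, zero_add] at hcv
  linarith

lemma mm_mono : Monotone mm := by
  intro r s h
  rcases le_or_gt s 0 with hs | hs
  · unfold mm; rw [max_eq_right hs, max_eq_right (h.trans hs)]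
  · rcases le_or_gt r 0 with hr | hr
    · have : mm r = mm 0 := by unfold mm; rw [max_eq_right hr, max_self]
      rw [this]
      refine (mm_scale le_rfl hs hs.le).trans ?_
      simp [mm_nonneg]
    · refine (mm_scale hr.le hs h).trans ?_
      have := (div_le_one hs).2 h
      have := mm_nonneg s
      nlinarith

def mu (r : ℝ) : ℝ := min (mm r) (mm 1)
lemma mu_cont : Continuous mu := mm_cont.min continuous_const
lemma mu_mono : Monotone mu := fun _ _ h => min_le_min_right _ (mm_mono h)
lemma mu_pos {r : ℝ} (h : 0 < r) : 0 < mu r := lt_min (mm_pos h) (mm_pos one_pos)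
lemma mu_nonneg (r : ℝ) : 0 ≤ mu r := le_min (mm_nonneg r) (mm_nonneg 1)
def Ps (s : ℝ) : ℝ := ∫ r in (0 : ℝ)..s, mu r

lemma Ps_deriv (s : ℝ) : HasDerivAt Ps (mu s) s :=
  intervalIntegral.integral_hasDerivAt_right (mu_cont.intervalIntegrable _ _)
    (mu_cont.stronglyMeasurableAtFilter _ _) mu_cont.continuousAt

lemma deriv_Ps : deriv Ps = mu := funext fun s => (Ps_deriv s).deriv

lemma Ps_convex : ConvexOn ℝ univ Ps :=
  Monotone.convexOn_univ_of_deriv (fun s => (Ps_deriv s).differentiableAt) (by rw [deriv_Ps]; exact mu_mono)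

lemma Ps_contDiff : ContDiff ℝ 1 Ps := by
  rw [contDiff_one_iff_deriv, deriv_Ps]
  exact ⟨fun s => (Ps_deriv s).differentiableAt, mu_cont⟩

lemma Ps_pos {s : ℝ} (h : 0 < s) : 0 < Ps s :=
  intervalIntegral.intervalIntegral_pos_of_pos_on (mu_cont.intervalIntegrable _ _) (fun x hx => mu_pos hx.1) h

lemma Ps_le {s : ℝ} (h : 0 < s) : Ps s ≤ mm s := by
  have h1 : Ps s ≤ ∫ r in (0 : ℝ)..s, mu s :=
    intervalIntegral.integral_mono_on h.le (mu_cont.intervalIntegrable _ _) (by simp)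
      (fun x hx => mu_mono hx.2)
  rw [intervalIntegral.integral_const, sub_zero, smul_eq_mul] at h1
  refine h1.trans ?_
  rcases le_total s 1 with hs | hs
  · have : mu s ≤ mm s := min_le_left _ _
    have := mu_nonneg s
    nlinarith
  · have h2 := mm_scale zero_le_one h hs
    rw [div_mul_eq_mul_div, one_mul, le_div_iff₀ h] at h2
    have : mu s ≤ mm 1 := min_le_right _ _
    nlinarith

lemma Ps_bound (x : EE) : Ps (infDist x (closedBall (0 : EE) 1)) ≤ ff x := by
  rcases le_or_gt ‖x‖ 1 with h | h
  · rw [infDist_zero_of_mem (by simpa using h)]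
    simp [Ps, ff_nonneg]
  · have hx0 : ‖x‖ ≠ 0 := by linarith
    have hle : infDist x (closedBall (0 : EE) 1) ≤ ‖x‖ - 1 := by
      have hm : (‖x‖⁻¹ • x) ∈ closedBall (0 : EE) 1 := by
        simp [norm_smul, hx0]
      refine (infDist_le_dist_of_mem hm).trans (le_of_eq ?_)
      rw [dist_eq_norm]
      have : x - ‖x‖⁻¹ • x = (1 - ‖x‖⁻¹) • x := by module
      rw [this, norm_smul, Real.norm_eq_abs, abs_of_nonneg (sub_nonneg.2 (inv_le_one_of_one_le₀ h.le))]
      field_simp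
    have hmono : Monotone Ps := monotone_of_deriv_nonneg (fun s => (Ps_deriv s).differentiableAt)
      (fun s => by rw [deriv_Ps]; exact mu_nonneg s)
    refine (hmono hle).trans ((Ps_le (by linarith)).trans ?_)
    refine (mm_le (‖x‖ - 1) (‖x‖⁻¹ • x) (by simp [norm_smul, hx0])).trans (le_of_eq ?_)
    rw [max_eq_left (by linarith), smul_smul]
    congr 1
    rw [show (1 + (‖x‖ - 1)) * ‖x‖⁻¹ = 1 by field_simp; ring, one_smul]

/-- **Theorem 6.2** (error bounds do not imply KL): there exists a twice
continuously differentiable convex function `f : ℝ² → ℝ` with `min f = 0` and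
`argmin f` equal to the closed unit disk, such that
(a) `f` satisfies a smooth error bound: there is a convex, continuously
differentiable residual `Ψ : [0,∞) → [0,∞)` with `Ψ(0) = 0`, `Ψ > 0` on
`(0,∞)` and `f(x) ≥ Ψ(dist(x, argmin f))` for all `x`; and
(b) `f` fails every Kurdyka–Łojasiewicz inequality: for every `r₀ > 0` and every
`φ ∈ 𝒦(0,r₀)` (with derivative `φ'`) there is a point `x` with
`0 < f(x) < r₀` and `φ'(f(x))·‖∇f(x)‖ < 1`. -/
theorem stmt18 :
    ∃ f : EuclideanSpace ℝ (Fin 2) → ℝ,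
      ContDiff ℝ 2 f ∧ ConvexOn ℝ Set.univ f ∧
      {x : EuclideanSpace ℝ (Fin 2) | ∀ y, f x ≤ f y} = closedBall 0 1 ∧
      (∀ x ∈ closedBall (0 : EuclideanSpace ℝ (Fin 2)) 1, f x = 0) ∧
      (∃ Ψ : ℝ → ℝ, ConvexOn ℝ (Ici 0) Ψ ∧ ContDiffOn ℝ 1 Ψ (Ici 0) ∧
        Ψ 0 = 0 ∧ (∀ s : ℝ, 0 ≤ s → 0 ≤ Ψ s) ∧ (∀ s : ℝ, 0 < s → 0 < Ψ s) ∧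
        ∀ x : EuclideanSpace ℝ (Fin 2),
          Ψ (Metric.infDist x (closedBall (0 : EuclideanSpace ℝ (Fin 2)) 1)) ≤ f x) ∧
      (∀ r0 : ℝ, 0 < r0 → ∀ φ φ' : ℝ → ℝ,
        ContinuousOn φ (Ico 0 r0) →
        (∀ s ∈ Ioo (0 : ℝ) r0, HasDerivAt φ (φ' s) s) →
        ContinuousOn φ' (Ioo 0 r0) →
        ConcaveOn ℝ (Ico 0 r0) φ →
        φ 0 = 0 →
        (∀ s ∈ Ioo (0 : ℝ) r0, 0 < φ' s) →
        ∃ x : EuclideanSpace ℝ (Fin 2),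
          0 < f x ∧ f x < r0 ∧ φ' (f x) * ‖gradient f x‖ < 1) := by
  refine ⟨ff, ff_contDiff, ff_convex, ?_, fun x hx => ff_zero (by simpa using hx),
    ⟨Ps, Ps_convex.subset (subset_univ _) (convex_Ici 0), Ps_contDiff.contDiffOn, by simp [Ps],
      fun s hs => ?_, fun s hs => Ps_pos hs, Ps_bound⟩, ?_⟩
  · ext x
    simp only [mem_ofPred_eq, mem_closedBall, dist_zero_right]
    constructor
    · intro h
      by_contra! hx
      have h1 := h 0
      rw [ff_zero (x := 0) (by simp)] at h1
      linarith [ff_pos hx]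
    · intro hx y
      rw [ff_zero hx]; exact ff_nonneg y
  · rcases hs.eq_or_lt with h | h
    · rw [← h]; simp [Ps]
    · exact (Ps_pos h).le
  · intro r0 hr φ φ' _ hd _ hc h0 hp
    exact kl_fail r0 hr φ φ' hd hc h0 hp
end
end
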